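/- Let F be a field of characteristic zero and L a nonzero finite-dimensional Lie algebra over F with only finitely many Lie ideals. Then the Frattini subalgebra of L is zero if and only if the Jacobson radical ⁅L, Rad(L)⁆ is contained in the abelian socle Asoc(L) and ⁅L, Rad(L)⁆ ⊓ Z(L) = ⊥. -/

import Mathlib

open LieAlgebra LieModule Module
open scoped TensorProduct

section TraceNilpotent

variable {F V : Type*} [Field F] [CharZero F] [AddCommGroup V] [Module F V] [FiniteDimensional F V]

theorem LinearMap.isNilpotent_of_trace_pow_eq_zero (f : Module.End F V)
    (h : ∀ n, LinearMap.trace F V (f ^ (n + 1)) = 0) : IsNilpotent f := by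
  have hp : ∀ p : Polynomial F, Polynomial.X ∣ p →
      LinearMap.trace F V (Polynomial.aeval f p) = 0 := by
    rintro _ ⟨p, rfl⟩
    rw [Polynomial.aeval_eq_sum_range]
    rw [map_sum]
    refine Finset.sum_eq_zero fun i _ => ?_
    rcases i with _ | i
    · simp
    · simp [h]
  obtain ⟨m, q, hq, hXq⟩ : ∃ (m : ℕ) (q : Polynomial F),
      minpoly F f = Polynomial.X ^ m * q ∧ ¬ Polynomial.X ∣ q := by
    obtain ⟨q, hq, hXq⟩ := (minpoly F f).exists_eq_pow_rootMultiplicity_mul_and_not_dvd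
      (minpoly.ne_zero (Algebra.IsIntegral.isIntegral f)) 0
    rw [map_zero, sub_zero] at hq hXq
    exact ⟨_, q, hq, hXq⟩
  have hcop : IsCoprime (Polynomial.X : Polynomial F) q :=
    (Polynomial.irreducible_X.coprime_iff_not_dvd).mpr hXq
  have hcop' : IsCoprime ((Polynomial.X : Polynomial F) ^ (m + 1)) q := hcop.pow_left
  obtain ⟨a, b, hab⟩ := hcop'
  obtain ⟨e, hedef⟩ : ∃ e, e = Polynomial.aeval f (a * Polynomial.X ^ (m + 1)) := ⟨_, rfl⟩
  have hzero : Polynomial.aeval f ((a * Polynomial.X ^ (m + 1)) * (b * q)) = 0 := by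
    have : (a * Polynomial.X ^ (m + 1)) * (b * q) = (a * b * Polynomial.X) * minpoly F f := by
      rw [hq]; ring
    rw [this, map_mul, minpoly.aeval, mul_zero]
  have he : IsIdempotentElem e := by
    have h1 : Polynomial.aeval f (b * q) = 1 - e := by
      rw [eq_sub_iff_add_eq', hedef, ← map_add, hab, map_one]
    rw [map_mul, h1, ← hedef, mul_sub, mul_one, sub_eq_zero] at hzero
    exact hzero.symm
  have htr : LinearMap.trace F V e = 0 := by
    rw [hedef]
    exact hp _ (Dvd.dvd.mul_left (dvd_pow_self _ (Nat.succ_ne_zero m)) _)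
  have he0 : e = 0 := by
    have h2 := (LinearMap.IsIdempotentElem.isProj_range e he).trace
    rw [htr] at h2
    have h3 : finrank F (LinearMap.range e) = 0 := by exact_mod_cast h2.symm
    rw [Submodule.finrank_eq_zero] at h3
    exact LinearMap.range_eq_bot.mp h3
  have hb : Polynomial.aeval f (b * q) = 1 := by
    have : Polynomial.aeval f (a * Polynomial.X ^ (m + 1) + b * q) = 1 := by rw [hab, map_one]
    rwa [map_add, ← hedef, he0,
      zero_add] at this
  refine ⟨m, ?_⟩
  calc f ^ m = f ^ m * Polynomial.aeval f (b * q) := by rw [hb, mul_one]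
    _ = Polynomial.aeval f (Polynomial.X ^ m * (b * q)) := by simp
    _ = Polynomial.aeval f (b * minpoly F f) := by rw [hq]; congr 1; ring
    _ = 0 := by simp

end TraceNilpotent

section Irreducible

variable {F L V : Type*} [Field F] [CharZero F] [LieRing L] [LieAlgebra F L]
  [AddCommGroup V] [Module F V] [FiniteDimensional F V] [LieRingModule L V] [LieModule F L V]

omit [CharZero F] [FiniteDimensional F V] in
theorem toEnd_lie_eq (x y : L) :
    toEnd F L V ⁅x, y⁆ = toEnd F L V x * toEnd F L V y - toEnd F L V y * toEnd F L V x := by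
  ext v
  simp

omit [CharZero F] [FiniteDimensional F V] in
theorem toEnd_commute_of_lie_lie_eq_zero {x y : L} (h : ∀ v : V, ⁅⁅x, y⁆, v⁆ = 0) :
    Commute (toEnd F L V x) (toEnd F L V y) := by
  have : toEnd F L V ⁅x, y⁆ = 0 := by ext v; simpa using h v
  rw [toEnd_lie_eq, sub_eq_zero] at this
  exact this

theorem isNilpotent_toEnd_lie_of_lie_lie_eq_zero {x y : L}
    (h : ∀ v : V, ⁅⁅⁅x, y⁆, y⁆, v⁆ = 0) : IsNilpotent (toEnd F L V ⁅x, y⁆) := by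
  have hc := toEnd_commute_of_lie_lie_eq_zero (F := F) h
  refine LinearMap.isNilpotent_of_trace_pow_eq_zero _ fun n => ?_
  have hc' := hc.pow_left n
  rw [pow_succ]
  nth_rewrite 2 [toEnd_lie_eq]
  rw [mul_sub, map_sub, ← mul_assoc, ← mul_assoc, hc'.eq, mul_assoc (toEnd F L V y),
    LinearMap.trace_mul_comm F (toEnd F L V y), sub_self]

omit [CharZero F] in
/-- An ideal acting by nilpotent endomorphisms on an irreducible module acts trivially. -/
theorem lie_eq_zero_of_isNilpotent_toEnd [IsIrreducible F L V] (N : LieIdeal F L)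
    (hnil : ∀ n ∈ N, IsNilpotent (toEnd F L V n)) : ∀ n ∈ N, ∀ v : V, ⁅n, v⁆ = 0 := by
  have hnilp : LieModule.IsNilpotent N V := by
    rw [LieModule.isNilpotent_iff_forall' (R := F)]
    rintro ⟨n, hn⟩
    exact hnil n hn
  have hne : Nontrivial V := LieModule.nontrivial_of_isIrreducible F L V
  let W : LieSubmodule F L V :=
    { carrier := {v | ∀ n ∈ N, ⁅n, v⁆ = 0}
      add_mem' := fun ha hb n hn => by rw [lie_add, ha n hn, hb n hn, add_zero]
      zero_mem' := fun n _ => lie_zero n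
      smul_mem' := fun c v hv n hn => by rw [lie_smul, hv n hn, smul_zero]
      lie_mem := fun {x v} hv n hn => by
        have h1 : ⁅⁅n, x⁆, v⁆ = 0 := hv _ (lie_mem_left F L _ _ _ hn)
        rw [leibniz_lie, h1, hv n hn, lie_zero, add_zero] }
  have hW : W ≠ ⊥ := by
    have h2 : Nontrivial (maxTrivSubmodule F N V) :=
      LieModule.nontrivial_max_triv_of_isNilpotent F _ V
    obtain ⟨⟨v, hv⟩, hv0⟩ := exists_ne (0 : maxTrivSubmodule F N V)
    intro hW
    have : v ∈ W := fun n hn => hv ⟨n, hn⟩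
    rw [hW, LieSubmodule.mem_bot] at this
    exact hv0 (Subtype.ext this)
  have hWt : W = ⊤ := (eq_bot_or_eq_top W).resolve_left hW
  intro n hn v
  have hv : v ∈ W := hWt ▸ LieSubmodule.mem_top v
  exact hv n hn

/-- In an irreducible module, an ideal `⁅P, Q⁆` that commutes with `Q` modulo the kernel of the
action acts trivially. -/
theorem lie_eq_zero_of_lie_lie_eq_zero [IsIrreducible F L V] (P Q : LieIdeal F L)
    (h : ∀ n ∈ ⁅P, Q⁆, ∀ q ∈ Q, ∀ v : V, ⁅⁅n, q⁆, v⁆ = 0) :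
    ∀ n ∈ ⁅P, Q⁆, ∀ v : V, ⁅n, v⁆ = 0 := by
  have hle : ⁅P, Q⁆ ≤ Q := LieSubmodule.lie_le_right Q P
  have hnil : ∀ n ∈ ⁅P, Q⁆, IsNilpotent (toEnd F L V n) := by
    intro n hn
    have hn' := hn
    rw [← LieSubmodule.mem_toSubmodule, LieSubmodule.lieIdeal_oper_eq_linear_span'] at hn'
    have : n ∈ ⁅P, Q⁆ ∧ IsNilpotent (toEnd F L V n) := by
      induction hn' using Submodule.span_induction with
      | mem x hx =>
        obtain ⟨p, hp, q, hq, rfl⟩ := hx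
        have hm := LieSubmodule.lie_mem_lie hp hq
        exact ⟨hm, isNilpotent_toEnd_lie_of_lie_lie_eq_zero (h _ hm q hq)⟩
      | zero => simp
      | add x y hx hy hx' hy' =>
        have hx2 := hx' (by rw [← LieSubmodule.mem_toSubmodule, LieSubmodule.lieIdeal_oper_eq_linear_span']; exact hx)
        have hy2 := hy' (by rw [← LieSubmodule.mem_toSubmodule, LieSubmodule.lieIdeal_oper_eq_linear_span']; exact hy)
        refine ⟨add_mem hx2.1 hy2.1, ?_⟩
        rw [map_add]
        exact (toEnd_commute_of_lie_lie_eq_zero (h _ hx2.1 y (hle hy2.1))).isNilpotent_add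
          hx2.2 hy2.2
      | smul c x hx hx' =>
        have hx2 := hx' (by rw [← LieSubmodule.mem_toSubmodule, LieSubmodule.lieIdeal_oper_eq_linear_span']; exact hx)
        refine ⟨Submodule.smul_mem _ c hx2.1, ?_⟩
        rw [map_smul]
        exact hx2.2.smul c
    exact this.2
  exact lie_eq_zero_of_isNilpotent_toEnd _ hnil

/-- `⁅L, rad L⁆` acts trivially on every irreducible module. -/
theorem lie_radical_lie_eq_zero [FiniteDimensional F L] [IsIrreducible F L V] :
    ∀ n ∈ ⁅(⊤ : LieIdeal F L), radical F L⁆, ∀ v : V, ⁅n, v⁆ = 0 := by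
  set D := fun k => LieAlgebra.derivedSeriesOfIdeal F L k (radical F L) with hD
  have hsucc : ∀ k, D (k + 1) = ⁅D k, D k⁆ := fun k => derivedSeriesOfIdeal_succ F L _ k
  obtain ⟨k, hk⟩ : ∃ k, D k = ⊥ := by
    have := (LieAlgebra.isSolvable_iff F (radical F L)).mp inferInstance
    obtain ⟨k, hk⟩ := this
    exact ⟨k, (LieIdeal.derivedSeries_eq_bot_iff _ k).mp hk⟩
  have step : ∀ k, (∀ n ∈ D (k + 1), ∀ v : V, ⁅n, v⁆ = 0) →
      ∀ n ∈ ⁅(⊤ : LieIdeal F L), D k⁆, ∀ v : V, ⁅n, v⁆ = 0 := fun k h =>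
    lie_eq_zero_of_lie_lie_eq_zero (F := F) _ _ fun n hn q hq => by
      refine h _ ?_
      rw [hsucc]
      exact LieSubmodule.lie_mem_lie (LieSubmodule.lie_le_right _ _ hn) hq
  have main : ∀ k, (∀ n ∈ D (k + 1), ∀ v : V, ⁅n, v⁆ = 0) → ∀ n ∈ D 1, ∀ v : V, ⁅n, v⁆ = 0 := by
    intro k
    induction k with
    | zero => exact id
    | succ k ih =>
      intro h
      refine ih ?_
      rw [hsucc]
      refine lie_eq_zero_of_lie_lie_eq_zero (F := F) _ _ fun n hn q hq => ?_
      refine step (k + 1) h _ ?_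
      rw [← lie_skew, neg_mem_iff]
      rw [hsucc]
      exact LieSubmodule.lie_mem_lie (LieSubmodule.mem_top q) hn
  refine step 0 (main k fun n hn v => ?_)
  have : D (k + 1) = ⊥ := by rw [hsucc, hk]; simp
  rw [this, LieSubmodule.mem_bot] at hn
  rw [hn, zero_lie]

end Irreducible

section RadicalQuotient

variable {F L : Type*} [Field F] [LieRing L] [LieAlgebra F L]

/-- The quotient map by a Lie ideal, as a morphism of Lie algebras. -/
def LieIdeal.quotientHom (I : LieIdeal F L) : L →ₗ⁅F⁆ L ⧸ I :=
  { (LieSubmodule.Quotient.mk' I : L →ₗ[F] L ⧸ I) with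
    map_lie' := fun {x y} => LieSubmodule.Quotient.mk_bracket (I := I) x y }

theorem LieIdeal.quotientHom_surjective (I : LieIdeal F L) :
    Function.Surjective I.quotientHom :=
  LieSubmodule.Quotient.surjective_mk' I

theorem LieIdeal.quotientHom_eq_zero {I : LieIdeal F L} {x : L} :
    I.quotientHom x = 0 ↔ x ∈ I :=
  LieSubmodule.Quotient.mk_eq_zero I

theorem LieIdeal.isLieAbelian_iff_lie_eq_zero {I : LieIdeal F L} :
    IsLieAbelian I ↔ ∀ x ∈ I, ∀ y ∈ I, ⁅x, y⁆ = 0 := by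
  rw [LieSubmodule.lie_abelian_iff_lie_self_eq_bot, LieSubmodule.lie_eq_bot_iff]

variable [FiniteDimensional F L]

omit [FiniteDimensional F L] in
theorem LieIdeal.isSolvable_of_lie_le {I J : LieIdeal F L} [IsSolvable I] (h : ⁅J, J⁆ ≤ I) :
    IsSolvable J := by
  obtain ⟨k, hk⟩ := (LieAlgebra.isSolvable_iff F I).mp inferInstance
  rw [LieIdeal.derivedSeries_eq_bot_iff] at hk
  refine (LieAlgebra.isSolvable_iff F J).mpr ⟨k + 1, ?_⟩
  rw [LieIdeal.derivedSeries_eq_bot_iff, derivedSeriesOfIdeal_add, eq_bot_iff, ← hk]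
  refine derivedSeriesOfIdeal_mono ?_ k
  simpa [derivedSeriesOfIdeal_succ] using h

theorem LieAlgebra.le_radical_of_lie_le {J : LieIdeal F L} (h : ⁅J, J⁆ ≤ radical F L) :
    J ≤ radical F L := by
  have := LieIdeal.isSolvable_of_lie_le h
  exact (LieIdeal.solvable_iff_le_radical F L J).mp this

instance LieAlgebra.hasTrivialRadical_quotient_radical :
    HasTrivialRadical F (L ⧸ radical F L) := by
  rw [hasTrivialRadical_iff_no_abelian_ideals]
  intro I hI
  rw [LieIdeal.isLieAbelian_iff_lie_eq_zero] at hI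
  have hJ : I.comap (radical F L).quotientHom ≤ radical F L := by
    refine le_radical_of_lie_le ?_
    rw [LieSubmodule.lie_le_iff]
    intro x hx y hy
    rw [← LieIdeal.quotientHom_eq_zero, LieHom.map_lie]
    rw [LieIdeal.mem_comap] at hx hy
    exact hI _ hx _ hy
  rw [eq_bot_iff]
  intro y hy
  obtain ⟨x, rfl⟩ := (radical F L).quotientHom_surjective y
  rw [LieSubmodule.mem_bot, LieIdeal.quotientHom_eq_zero]
  exact hJ hy

variable [CharZero F]

theorem LieIdeal.lie_self_eq_of_hasTrivialRadical [HasTrivialRadical F L] (I : LieIdeal F L) :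
    ⁅I, I⁆ = I := by
  refine le_antisymm (LieSubmodule.lie_le_right _ _) ?_
  have hc := LieIdeal.isCompl_killingCompl (K := F) (⁅I, I⁆ : LieIdeal F L)
  set K := LieIdeal.killingCompl F L (⁅I, I⁆ : LieIdeal F L)
  have hab : I ⊓ K = ⊥ := by
    refine hasTrivialRadical_iff_no_abelian_ideals F L |>.mp inferInstance _ ?_
    rw [LieIdeal.isLieAbelian_iff_lie_eq_zero]
    intro x hx y hy
    have : ⁅x, y⁆ ∈ (⁅I, I⁆ ⊓ K : LieIdeal F L) :=
      ⟨LieSubmodule.lie_mem_lie hx.1 hy.1, lie_mem_right F L K x y hy.2⟩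
    rwa [hc.inf_eq_bot, LieSubmodule.mem_bot] at this
  have h2 : I = ⁅I, I⁆ ⊔ (K ⊓ I) := by
    rw [← sup_inf_assoc_of_le K (LieSubmodule.lie_le_right I I), hc.sup_eq_top, top_inf_eq]
  rw [inf_comm, hab, sup_bot_eq] at h2
  exact h2.le

/-- Modulo the radical, every ideal is perfect. -/
theorem LieIdeal.le_lie_self_sup_radical (N : LieIdeal F L) :
    N ≤ ⁅N, N⁆ ⊔ radical F L := by
  intro x hx
  have h1 := LieIdeal.lie_self_eq_of_hasTrivialRadical (N.map (radical F L).quotientHom)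
  rw [← LieIdeal.map_bracket_eq _ (radical F L).quotientHom_surjective] at h1
  have h2 : (radical F L).quotientHom x ∈ N.map (radical F L).quotientHom :=
    LieIdeal.mem_map hx
  rw [← h1] at h2
  obtain ⟨⟨y, hy⟩, hxy⟩ :=
    LieIdeal.mem_map_of_surjective (radical F L).quotientHom_surjective h2
  rw [LieSubmodule.mem_sup]
  refine ⟨y, hy, x - y, ?_, by abel⟩
  rw [← LieIdeal.quotientHom_eq_zero, map_sub, sub_eq_zero]
  exact hxy.symm

end RadicalQuotient

section Casimir

variable {F L : Type*} [Field F] [LieRing L] [LieAlgebra F L]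
  {M : Type*} [AddCommGroup M] [Module F M] [LieRingModule L M] [LieModule F L M]

omit [LieAlgebra F L] [LieModule F L M] in
theorem LieSubmodule.isIrreducible_of_isAtom {W : LieSubmodule F L M} (hW : IsAtom W) :
    IsIrreducible F L W := by
  have : Nontrivial W := (LieSubmodule.nontrivial_iff_ne_bot F L M).mpr hW.1
  refine IsIrreducible.mk fun N hN => ?_
  have hle : N.map W.incl ≤ W := by
    rintro _ ⟨x, -, rfl⟩
    exact x.2
  have : N.map W.incl = W := by
    refine (hW.le_iff.mp hle).resolve_left fun h => hN ?_
    rw [eq_bot_iff]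
    intro x hx
    have : W.incl x ∈ N.map W.incl := LieSubmodule.mem_map_of_mem hx
    rw [h, LieSubmodule.mem_bot] at this
    exact Subtype.ext this
  rw [eq_top_iff]
  rintro ⟨x, hx⟩ -
  rw [← this] at hx
  obtain ⟨y, hy, hyx⟩ := hx
  have : y = ⟨x, hx⟩ := Subtype.ext hyx
  exact this ▸ hy

variable (F L M) in
/-- The kernel of the trace form of a module. -/
noncomputable def LieModule.traceFormKer : LieIdeal F L where
  toSubmodule := LinearMap.ker (traceForm F L M)
  lie_mem := by
    intro x y hy
    ext z
    have : traceForm F L M y = 0 := hy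
    rw [traceForm_apply_lie_apply', this]
    simp

theorem LieModule.mem_traceFormKer {x : L} :
    x ∈ traceFormKer F L M ↔ ∀ y, traceForm F L M x y = 0 := by
  change traceForm F L M x = 0 ↔ _
  rw [LinearMap.ext_iff]
  rfl

variable [CharZero F] [FiniteDimensional F L] [FiniteDimensional F M]

theorem LieModule.traceFormKer_lie_eq_zero [IsIrreducible F L M]
    (hrad : ∀ r ∈ radical F L, ∀ m : M, ⁅r, m⁆ = 0) :
    ∀ n ∈ traceFormKer F L M, ∀ m : M, ⁅n, m⁆ = 0 := by
  set N := traceFormKer F L M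
  have h0 : traceForm F N M = 0 := by
    ext x y
    exact mem_traceFormKer.mp x.2 y
  have h1 := isNilpotent_derivedSeries_of_traceForm_eq_zero h0
  rw [LieModule.isNilpotent_iff_forall' (R := F)] at h1
  have h2 : ∀ n ∈ ⁅N, N⁆, ∀ m : M, ⁅n, m⁆ = 0 := by
    refine lie_eq_zero_of_isNilpotent_toEnd (F := F) _ fun n hn => ?_
    have hn' : n ∈ N := LieSubmodule.lie_le_right N N hn
    have : (⟨n, hn'⟩ : N) ∈ derivedSeries F N 1 := by
      rw [LieIdeal.derivedSeries_eq_derivedSeriesOfIdeal_comap, LieIdeal.mem_comap,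
        derivedSeriesOfIdeal_succ, derivedSeriesOfIdeal_zero]
      exact hn
    exact h1 ⟨_, this⟩
  intro n hn m
  obtain ⟨a, ha, b, hb, rfl⟩ := LieSubmodule.mem_sup _ _ _ |>.mp
    (LieIdeal.le_lie_self_sup_radical N hn)
  rw [add_lie, h2 a ha, hrad b hb, add_zero]

omit [CharZero F] [FiniteDimensional F M] in
theorem LieModule.exists_dual_families_traceForm (h : traceFormKer F L M ≠ ⊤) :
    ∃ (n : ℕ) (x y : Fin n → L), n ≠ 0 ∧ (∀ i, traceForm F L M (x i) (y i) = 1) ∧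
      (∀ u, u - ∑ i, traceForm F L M u (y i) • x i ∈ traceFormKer F L M) ∧
      ∀ u, u - ∑ i, traceForm F L M u (x i) • y i ∈ traceFormKer F L M := by
  set N := traceFormKer F L M
  set B := traceForm F L M with hBdef
  obtain ⟨C, hC⟩ := Submodule.exists_isCompl N.toSubmodule
  have hker : ∀ u : L, (∀ c ∈ C, B u c = 0) → u ∈ N := by
    intro u hu
    rw [mem_traceFormKer]
    intro v
    obtain ⟨a, ha, c, hc, rfl⟩ := Submodule.mem_sup.mp
      (show v ∈ N.toSubmodule ⊔ C from hC.sup_eq_top ▸ Submodule.mem_top)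
    rw [map_add, ← hBdef, hu c hc, add_zero, hBdef, traceForm_comm]
    exact mem_traceFormKer.mp ha u
  have hsep : ∀ c : C, (∀ c' : C, B c c' = 0) → c = 0 := by
    intro c hc
    have h1 : (c : L) ∈ N.toSubmodule ⊓ C := ⟨hker c fun c' hc' => hc ⟨c', hc'⟩, c.2⟩
    rw [hC.inf_eq_bot, Submodule.mem_bot] at h1
    exact Subtype.ext h1
  have hnd : (B.restrict C).Nondegenerate :=
    ⟨hsep, fun c hc => hsep c fun c' => (traceForm_comm F L M _ _).trans (hc c')⟩
  have hsymm : (B.restrict C).IsSymm := ⟨fun c c' => traceForm_comm F L M _ _⟩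
  set b := Module.finBasis F C
  set d := (B.restrict C).dualBasis hnd b
  have hl : ∀ i j, B (d i) (b j) = if j = i then 1 else 0 :=
    (B.restrict C).apply_dualBasis_left hnd b
  have hr : ∀ i j, B (b i) (d j) = if i = j then 1 else 0 :=
    (B.restrict C).apply_dualBasis_right hnd hsymm b
  have horth : ∀ (e : Basis (Fin (finrank F C)) F C) (u : L),
      (∀ i, B u (e i) = 0) → u ∈ N := by
    intro e u hu
    refine hker u fun c hc => ?_
    have : (B u ∘ₗ C.subtype) = 0 := e.ext fun i => hu i
    exact LinearMap.congr_fun this ⟨c, hc⟩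
  refine ⟨finrank F C, fun i => b i, fun i => d i, fun h0 => h ?_, fun i => by simp [hr], ?_, ?_⟩
  · rw [Submodule.finrank_eq_zero] at h0
    rw [h0] at hC
    rw [← LieSubmodule.toSubmodule_inj, LieSubmodule.top_toSubmodule]
    simpa using hC.sup_eq_top
  · intro u
    refine horth d _ fun j => ?_
    simp [hr]
  · intro u
    refine horth b _ fun j => ?_
    simp [hl]

variable (F) in
/-- If `L` maps `M` into an irreducible submodule `W`, and the radical acts trivially,
then `W` has a complement on which `L` acts trivially. -/
theorem LieModule.exists_sub_lie_eq_zero_of_isAtom {W : LieSubmodule F L M} (hatom : IsAtom W)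
    (hrad : ∀ r ∈ radical F L, ∀ m : M, ⁅r, m⁆ = 0) (hW : ∀ (x : L) (m : M), ⁅x, m⁆ ∈ W) (m : M) :
    ∃ w ∈ W, ∀ x : L, ⁅x, m - w⁆ = 0 := by
  have hirr := LieSubmodule.isIrreducible_of_isAtom hatom
  set N := traceFormKer F L W
  have hNW : ∀ n ∈ N, ∀ w ∈ W, ⁅n, w⁆ = 0 := fun n hn w hw =>
    congrArg Subtype.val (traceFormKer_lie_eq_zero
      (fun r hr (w : W) => Subtype.ext (hrad r hr w)) n hn ⟨w, hw⟩)
  have hNN : ⁅N, N⁆ ≤ LieModule.ker F L M := by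
    rw [LieSubmodule.lie_le_iff]
    intro n hn n' hn'
    rw [LieModule.mem_ker]
    intro m
    rw [lie_lie, hNW n hn _ (hW _ _), hNW n' hn' _ (hW _ _), sub_zero]
  have hNM : ∀ n ∈ N, ∀ m : M, ⁅n, m⁆ = 0 := by
    intro n hn m
    obtain ⟨a, ha, b, hb, rfl⟩ := LieSubmodule.mem_sup _ _ _ |>.mp
      (LieIdeal.le_lie_self_sup_radical N hn)
    rw [add_lie, (LieModule.mem_ker F L M a).mp (hNN ha) m, hrad b hb, add_zero]
  by_cases htop : N = ⊤
  · exact ⟨0, W.zero_mem, fun x => hNM x (htop ▸ LieSubmodule.mem_top x) _⟩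
  obtain ⟨n, x, y, hn, hxy, hx, hy⟩ := exists_dual_families_traceForm htop
  set B := traceForm F L W
  have hx' : ∀ (u : L) (m : M), ⁅u, m⁆ = ∑ i, B u (y i) • ⁅x i, m⁆ := by
    intro u m
    have := hNM _ (hx u) m
    rw [sub_lie, sub_eq_zero] at this
    simpa [sum_lie] using this
  have hy' : ∀ (u : L) (m : M), ⁅u, m⁆ = ∑ i, B u (x i) • ⁅y i, m⁆ := by
    intro u m
    have := hNM _ (hy u) m
    rw [sub_lie, sub_eq_zero] at this
    simpa [sum_lie] using this
  let c : Module.End F M := ∑ i, toEnd F L M (x i) * toEnd F L M (y i)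
  have hc : ∀ m, c m = ∑ i, ⁅x i, ⁅y i, m⁆⁆ := fun m => by
    simp [c, LinearMap.sum_apply]
  have hcomm : ∀ (z : L) (m : M), c ⁅z, m⁆ = ⁅z, c m⁆ := by
    intro z m
    rw [hc, hc, lie_sum, ← sub_eq_zero, ← neg_eq_zero, neg_sub, ← Finset.sum_sub_distrib]
    have h1 : ∀ i, ⁅z, ⁅x i, ⁅y i, m⁆⁆⁆ - ⁅x i, ⁅y i, ⁅z, m⁆⁆⁆
        = ⁅⁅z, x i⁆, ⁅y i, m⁆⁆ + ⁅x i, ⁅⁅z, y i⁆, m⁆⁆ := by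
      intro i
      rw [leibniz_lie z (x i), leibniz_lie z (y i), lie_add]
      abel
    simp_rw [h1, Finset.sum_add_distrib, hx' ⁅z, x _⁆, hy' ⁅z, y _⁆, lie_sum, lie_smul]
    rw [Finset.sum_comm, ← Finset.sum_add_distrib]
    refine Finset.sum_eq_zero fun i _ => ?_
    rw [← Finset.sum_add_distrib]
    refine Finset.sum_eq_zero fun j _ => ?_
    rw [← add_smul, traceForm_apply_lie_apply', traceForm_comm F L W (x j), neg_add_cancel,
      zero_smul]
  have hcW : ∀ m, c m ∈ W := fun m => by
    rw [hc]
    exact W.toSubmodule.sum_mem fun i _ => hW _ _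
  let K : LieSubmodule F L W :=
    { LinearMap.ker (c ∘ₗ W.toSubmodule.subtype) with
      lie_mem := by
        intro z w hw
        have hw' : c w = 0 := hw
        change c ⁅z, (w : M)⁆ = 0
        rw [hcomm, hw', lie_zero] }
  have hK : K ≠ ⊤ := by
    intro hK
    have h1 : ∀ w : W, c w = 0 := fun w => by
      have : w ∈ K := hK ▸ LieSubmodule.mem_top w
      exact this
    have h2 : ∑ i, toEnd F L W (x i) * toEnd F L W (y i) = 0 := by
      ext w
      have := h1 w
      rw [hc] at this
      simpa [LinearMap.sum_apply] using this
    have h3 := congrArg (LinearMap.trace F W) h2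
    rw [map_sum, map_zero] at h3
    have h4 : ∀ i, LinearMap.trace F W (toEnd F L W (x i) * toEnd F L W (y i)) = 1 := hxy
    simp [h4] at h3
    exact hn h3
  have hK : K = ⊥ := (eq_bot_or_eq_top K).resolve_right hK
  have hinj : ∀ w ∈ W, c w = 0 → w = 0 := by
    intro w hw h
    have : (⟨w, hw⟩ : W) ∈ K := h
    rw [hK, LieSubmodule.mem_bot] at this
    exact congrArg Subtype.val this
  let cW : W →ₗ[F] W := LinearMap.codRestrict W.toSubmodule (c ∘ₗ W.toSubmodule.subtype)
    fun w => hcW w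
  have hsurj : Function.Surjective cW := by
    rw [← LinearMap.injective_iff_surjective, injective_iff_map_eq_zero]
    intro w hw
    exact Subtype.ext (hinj w w.2 (congrArg Subtype.val hw))
  obtain ⟨w, hw⟩ := hsurj ⟨c m, hcW m⟩
  refine ⟨w, w.2, fun z => hinj _ (hW _ _) ?_⟩
  have hw' : c w = c m := congrArg Subtype.val hw
  rw [hcomm, map_sub, hw', sub_self, lie_zero]

variable (F) in
theorem LieModule.exists_sub_lie_mem_of_covBy {A W B : LieSubmodule F L M} (hAW : A ⋖ W)
    (hWB : W ≤ B) (hrad : ∀ r ∈ radical F L, ∀ b ∈ B, ⁅r, b⁆ ∈ A)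
    (hW : ∀ (x : L), ∀ b ∈ B, ⁅x, b⁆ ∈ W) {b : M} (hb : b ∈ B) :
    ∃ w ∈ W, ∀ x : L, ⁅x, b - w⁆ ∈ A := by
  let A' := A.comap B.incl
  let q := LieSubmodule.Quotient.mk' A'
  have hq : Function.Surjective q := LieSubmodule.Quotient.surjective_mk' A'
  have hq0 : ∀ b : B, q b = 0 ↔ (b : M) ∈ A := fun b => LieSubmodule.Quotient.mk_eq_zero A'
  let W' := (W.comap B.incl).map q
  have hatom : IsAtom W' := by
    constructor
    · intro h
      refine hAW.lt.not_ge fun w hw => ?_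
      have h1 : q ⟨w, hWB hw⟩ ∈ W' := LieSubmodule.mem_map_of_mem (N := W.comap B.incl) hw
      rw [h, LieSubmodule.mem_bot, hq0] at h1
      exact h1
    · intro N hN
      have h1 : A ≤ (N.comap q).map B.incl := by
        intro a ha
        refine ⟨⟨a, hWB (hAW.le ha)⟩, ?_, rfl⟩
        have : q ⟨a, hWB (hAW.le ha)⟩ = 0 := (hq0 _).mpr ha
        change q _ ∈ N
        rw [this]
        exact N.zero_mem
      have h2 : (N.comap q).map B.incl ≤ W := by
        rintro _ ⟨x, hx, rfl⟩
        obtain ⟨y, hy, hyx⟩ := hN.le hx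
        have h3 : q (y - x) = 0 := by
          rw [map_sub, sub_eq_zero]
          exact hyx
        rw [hq0] at h3
        have h4 := W.sub_mem (show (y : M) ∈ W from hy) (hAW.le h3)
        rw [AddSubgroupClass.coe_sub, sub_sub_cancel] at h4
        exact h4
      rcases hAW.eq_or_eq h1 h2 with h | h
      · rw [eq_bot_iff]
        intro y hy
        obtain ⟨x, rfl⟩ := hq y
        rw [LieSubmodule.mem_bot, hq0, ← h]
        exact ⟨x, hy, rfl⟩
      · refine absurd hN (not_lt_of_ge ?_)
        rintro _ ⟨x, hx, rfl⟩
        have hx' : (x : M) ∈ W := hx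
        rw [← h] at hx'
        obtain ⟨y, hy, hyx⟩ := hx'
        have : y = x := Subtype.ext hyx
        exact this ▸ hy
  obtain ⟨w', ⟨w, hw, rfl⟩, h⟩ := exists_sub_lie_eq_zero_of_isAtom F hatom
    (fun r hr m => by
      obtain ⟨x, rfl⟩ := hq m
      rw [← LieModuleHom.map_lie, hq0]
      exact hrad r hr x x.2)
    (fun x m => by
      obtain ⟨y, rfl⟩ := hq m
      rw [← LieModuleHom.map_lie]
      exact LieSubmodule.mem_map_of_mem (N := W.comap B.incl) (hW x y y.2)) (q ⟨b, hb⟩)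
  refine ⟨w, hw, fun x => ?_⟩
  have h1 : q ⁅x, (⟨b, hb⟩ - w : B)⁆ = 0 := by
    rw [LieModuleHom.map_lie, map_sub]
    exact h x
  rw [hq0] at h1
  exact h1

variable (F) in
/-- A relative form of the theorem of Weyl: if `L` maps `B` into `W` and the radical maps `B` into
`A ≤ W`, then each element of `B` is congruent modulo `W` to one that `L` maps into `A`. -/
theorem LieModule.exists_sub_lie_mem {A W B : LieSubmodule F L M} (hAW : A ≤ W)
    (hWB : W ≤ B) (hrad : ∀ r ∈ radical F L, ∀ b ∈ B, ⁅r, b⁆ ∈ A)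
    (hW : ∀ (x : L), ∀ b ∈ B, ⁅x, b⁆ ∈ W) {b : M} (hb : b ∈ B) :
    ∃ w ∈ W, ∀ x : L, ⁅x, b - w⁆ ∈ A := by
  induction A using WellFoundedGT.induction generalizing b with
  | ind A ih =>
    rcases hAW.eq_or_lt with rfl | hlt
    · exact ⟨0, A.zero_mem, fun x => by simpa using hW x b hb⟩
    have := LieSubmodule.wellFoundedLT_of_isArtinian F L M
    obtain ⟨W', hcov, hW'⟩ := exists_covBy_le_of_lt hlt
    obtain ⟨w, hw, h⟩ := ih W' hcov.lt hW' (fun r hr b hb => hcov.le (hrad r hr b hb)) hb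
    let B' : LieSubmodule F L M :=
      { carrier := {e | e ∈ B ∧ ∀ x : L, ⁅x, e⁆ ∈ W'}
        add_mem' := fun ha hb => ⟨B.add_mem ha.1 hb.1, fun x => by
          rw [lie_add]
          exact W'.add_mem (ha.2 x) (hb.2 x)⟩
        zero_mem' := ⟨B.zero_mem, fun x => by simp⟩
        smul_mem' := fun c e he => ⟨B.smul_mem c he.1, fun x => by
          rw [lie_smul]
          exact W'.smul_mem c (he.2 x)⟩
        lie_mem := fun {x e} he => ⟨B.lie_mem he.1, fun y => W'.lie_mem (he.2 x)⟩ }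
    obtain ⟨w', hw', h'⟩ := exists_sub_lie_mem_of_covBy F hcov (B := B')
      (fun e he => ⟨hWB (hW' he), fun x => W'.lie_mem he⟩)
      (fun r hr e he => hrad r hr e he.1) (fun x e he => he.2 x)
      (b := b - w) ⟨B.sub_mem hb (hWB hw), h⟩
    exact ⟨w + w', W.add_mem hw (hW' hw'), fun x => by simpa [sub_sub] using h' x⟩

end Casimir

section Orbit

theorem Submodule.mem_of_infinite_setOf_sum_pow_smul_mem {K V : Type*} [Field K] [AddCommGroup V]
    [Module K V] (p : Submodule K V) (n : ℕ) (u : ℕ → V)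
    (h : {t : K | ∑ k ∈ Finset.range n, t ^ k • u k ∈ p}.Infinite) {k : ℕ} (hk : k < n) :
    u k ∈ p := by
  by_contra hu
  obtain ⟨f, hf, hpf⟩ := p.exists_le_ker_of_notMem hu
  let q : Polynomial K := ∑ k ∈ Finset.range n, Polynomial.C (f (u k)) * Polynomial.X ^ k
  have hq : q = 0 := by
    refine Polynomial.eq_zero_of_infinite_isRoot q (h.mono fun t ht => ?_)
    have := hpf ht
    rw [LinearMap.mem_ker, map_sum] at this
    simp only [map_smul, smul_eq_mul] at this
    simp only [Set.mem_ofPred_eq, Polynomial.IsRoot, q, Polynomial.eval_finsetSum,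
      Polynomial.eval_mul, Polynomial.eval_C, Polynomial.eval_pow, Polynomial.eval_X]
    rw [← this]
    exact Finset.sum_congr rfl fun _ _ => mul_comm _ _
  have := congrArg (fun r => r.coeff k) hq
  simp only [q, Polynomial.finsetSum_coeff, Polynomial.coeff_C_mul, Polynomial.coeff_X_pow,
    mul_ite, mul_one, mul_zero, Finset.sum_ite_eq, Finset.mem_range, hk, if_true,
    Polynomial.coeff_zero] at this
  exact hf this

variable {K L : Type*} [Field K] [CharZero K] [LieRing L] [LieAlgebra K L]

theorem LieAlgebra.exists_lieEquiv_apply_eq_sum {e : L} (he : IsNilpotent (ad K L e)) :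
    ∃ n > 1, ∃ c : ℕ → K, c 0 = 1 ∧ c 1 = 1 ∧ ∀ t : K, ∃ φ : L ≃ₗ⁅K⁆ L,
      ∀ z, φ z = ∑ k ∈ Finset.range n, t ^ k • c k • (ad K L e ^ k) z := by
  obtain ⟨m, hm⟩ := he
  refine ⟨m + 2, by omega, fun k => (k.factorial : K)⁻¹, by simp, by simp, fun t => ?_⟩
  let _ : Module ℚ L := Module.compHom L (algebraMap ℚ K)
  let _ : LieAlgebra ℚ L := { lie_smul := fun t x y => lie_smul (algebraMap ℚ K t) x y }
  have had : (LieDerivation.ad K L (t • e)).toLinearMap = t • ad K L e := by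
    ext x; simp
  have hnil' : (LieDerivation.ad K L (t • e)).toLinearMap ^ (m + 2) = 0 := by
    rw [had, smul_pow, pow_add (ad K L e), hm, zero_mul, smul_zero]
  have hnil : IsNilpotent (LieDerivation.ad K L (t • e)).toLinearMap := ⟨_, hnil'⟩
  refine ⟨LieDerivation.exp _ hnil, fun z => ?_⟩
  rw [LieDerivation.exp_map_apply, IsNilpotent.exp_eq_sum hnil', had, LinearMap.sum_apply]
  refine Finset.sum_congr rfl fun k _ => ?_
  rw [smul_pow]
  change algebraMap ℚ K _ • t ^ k • (ad K L e ^ k) z = _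
  rw [smul_comm]
  simp

theorem LieAlgebra.exists_lieEquiv_forall_apply_ne_zero
    (hgen : LieSubalgebra.lieSpan K L {e | IsNilpotent (ad K L e)} = ⊤)
    {x : L} (hx : ∀ I : LieIdeal K L, x ∈ I → I = ⊤) {ι : Type*} (g : ι → Dual K L)
    (hg : ∀ i, g i ≠ 0) (s : Finset ι) :
    ∃ φ : L ≃ₗ⁅K⁆ L, ∀ i ∈ s, g i (φ x) ≠ 0 := by
  classical
  induction s using Finset.induction_on with
  | empty => exact ⟨LieEquiv.refl, by simp⟩
  | insert j s _ ih =>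
    obtain ⟨φ₀, hφ₀⟩ := ih
    by_contra! hcon
    let O : Set L := {z | ∃ φ : L ≃ₗ⁅K⁆ L, φ x = z ∧ ∀ i ∈ s, g i (φ x) ≠ 0}
    let V := Submodule.span K O
    have hmem : ∀ e : L, IsNilpotent (ad K L e) → ∀ z ∈ V, ⁅e, z⁆ ∈ V := by
      intro e he z hz
      obtain ⟨n, hn, c, hc0, hc1, hφ⟩ := exists_lieEquiv_apply_eq_sum he
      induction hz using Submodule.span_induction with
      | zero => simp
      | add y z _ _ hy hz => rw [lie_add]; exact add_mem hy hz
      | smul a z _ hz => rw [lie_smul]; exact V.smul_mem a hz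
      | mem z hz =>
        obtain ⟨ψ, rfl, hψ⟩ := hz
        let u : ℕ → L := fun k => c k • (ad K L e ^ k) (ψ x)
        have := V.mem_of_infinite_setOf_sum_pow_smul_mem n u ?_ hn
        · simpa [u, hc1] using this
        let q : ι → Polynomial K := fun i =>
          ∑ k ∈ Finset.range n, Polynomial.C (g i (u k)) * Polynomial.X ^ k
        have hq0 : ∀ i ∈ s, q i ≠ 0 := by
          intro i hi h0
          have := congrArg (fun r => r.coeff 0) h0
          simp only [q, Polynomial.finsetSum_coeff, Polynomial.coeff_C_mul,
            Polynomial.coeff_X_pow, mul_ite, mul_one, mul_zero, Finset.sum_ite_eq,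
            Finset.mem_range, (by omega : 0 < n), if_true, Polynomial.coeff_zero] at this
          exact hψ i hi (by simpa [u, hc0] using this)
        have hfin : {t : K | (∏ i ∈ s, q i).IsRoot t}.Finite := by
          rw [← Set.not_infinite]
          exact fun h => Finset.prod_ne_zero_iff.mpr hq0
            (Polynomial.eq_zero_of_infinite_isRoot _ h)
        refine hfin.infinite_compl.mono fun t ht => Submodule.subset_span ?_
        obtain ⟨χ, hχ⟩ := hφ t
        refine ⟨ψ.trans χ, hχ (ψ x), fun i hi h0 => ht ?_⟩
        have h1 : g i (∑ k ∈ Finset.range n, t ^ k • u k) = 0 := by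
          rw [← h0]; exact congrArg (g i) (hχ (ψ x)).symm
        rw [Set.mem_ofPred_eq, Polynomial.IsRoot, Polynomial.eval_prod]
        refine Finset.prod_eq_zero hi ?_
        rw [map_sum] at h1
        simp only [q, Polynomial.eval_finsetSum,
          Polynomial.eval_mul, Polynomial.eval_C, Polynomial.eval_pow, Polynomial.eval_X]
        rw [← h1]
        exact Finset.sum_congr rfl fun k _ => by
          rw [mul_comm]; exact ((g i).map_smul _ _).symm
    have hideal : ∀ y : L, ∀ z ∈ V, ⁅y, z⁆ ∈ V := by
      intro y
      have hy : y ∈ LieSubalgebra.lieSpan K L {e | IsNilpotent (ad K L e)} := by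
        rw [hgen]; exact LieSubalgebra.mem_top y
      induction hy using LieSubalgebra.lieSpan_induction with
      | mem e he => exact hmem e he
      | zero => simp
      | add a b _ _ ha hb => intro z hz; rw [add_lie]; exact add_mem (ha z hz) (hb z hz)
      | smul r a _ ha => intro z hz; rw [smul_lie]; exact V.smul_mem r (ha z hz)
      | lie a b _ _ ha hb =>
        intro z hz
        rw [lie_lie]
        exact sub_mem (ha _ (hb z hz)) (hb _ (ha z hz))
    let I : LieIdeal K L := { V with lie_mem := fun {y z} hz => hideal y z hz }
    have hI : I.comap φ₀.toLieHom = ⊤ := hx _ <| by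
      rw [LieIdeal.mem_comap]
      exact Submodule.subset_span ⟨φ₀, rfl, hφ₀⟩
    refine hg j (LinearMap.ext fun z => ?_)
    have hz : φ₀.symm z ∈ I.comap φ₀.toLieHom := by rw [hI]; exact LieSubmodule.mem_top _
    rw [LieIdeal.mem_comap] at hz
    have hzV : z ∈ V := by
      have h2 : φ₀ (φ₀.symm z) ∈ V := hz
      rwa [LieEquiv.apply_symm_apply] at h2
    have hle : V ≤ LinearMap.ker (g j) := by
      rw [Submodule.span_le]
      rintro _ ⟨φ, rfl, hφ⟩
      obtain ⟨i, hi, hi0⟩ := hcon φ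
      rcases Finset.mem_insert.mp hi with rfl | hi
      · exact hi0
      · exact absurd hi0 (hφ i hi)
    exact hle hzV

end Orbit

section GenFamily

/-- Iterated brackets `(ad h)ᵏ⁺¹ x` and the brackets between any two of these. -/
def LieAlgebra.adFamily {K L : Type*} [CommRing K] [LieRing L] [LieAlgebra K L] (h x : L) :
    ℕ ⊕ ℕ × ℕ → L :=
  Sum.elim (fun k => (ad K L h ^ (k + 1)) x)
    fun p => ⁅(ad K L h ^ (p.1 + 1)) x, (ad K L h ^ (p.2 + 1)) x⁆

variable {K L : Type*} [Field K] [CharZero K] [LieRing L] [LieAlgebra K L]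

omit [CharZero K] in
theorem LieEquiv.ad_pow_apply (φ : L ≃ₗ⁅K⁆ L) (h x : L) (k : ℕ) :
    φ ((ad K L h ^ k) x) = (ad K L (φ h) ^ k) (φ x) := by
  induction k with
  | zero => simp
  | succ k ih =>
    rw [pow_succ', pow_succ', Module.End.mul_apply, Module.End.mul_apply, ← ih]
    exact φ.toLieHom.map_lie _ _

omit [CharZero K] in
theorem LieAlgebra.span_adFamily_eq_top_of_lieEquiv (φ : L ≃ₗ⁅K⁆ L) {h x : L}
    (hs : Submodule.span K (Set.range (adFamily (K := K) h x)) = ⊤) :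
    Submodule.span K (Set.range (adFamily (K := K) (φ h) (φ x))) = ⊤ := by
  have : adFamily (K := K) (φ h) (φ x) = φ.toLinearEquiv ∘ adFamily (K := K) h x := by
    funext i
    rcases i with k | p
    · exact (φ.ad_pow_apply h x _).symm
    · change ⁅_, _⁆ = φ ⁅_, _⁆
      rw [← φ.ad_pow_apply, ← φ.ad_pow_apply]
      exact (φ.toLieHom.map_lie _ _).symm
  rw [this, Set.range_comp, ← LinearEquiv.coe_toLinearMap, Submodule.span_image, hs]
  simp

variable [FiniteDimensional K L] [IsKilling K L]

section Cartan

variable (H : LieSubalgebra K L) [H.IsCartanSubalgebra] [IsTriangularizable K H L]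

theorem LieAlgebra.IsKilling.eq_top_of_rootSpace_le (U : Submodule K L)
    (h1 : ∀ α : Weight K H L, α.IsNonZero → ∀ y ∈ rootSpace H α, y ∈ U)
    (h2 : ∀ α : Weight K H L, α.IsNonZero →
      ∀ y ∈ rootSpace H α, ∀ z ∈ rootSpace H (-α), ⁅y, z⁆ ∈ U) : U = ⊤ := by
  have hH : ∀ h : H, (h : L) ∈ U := by
    intro h
    have hh : h ∈ (⨆ α : Weight K H L, ⨆ (_ : α.IsNonZero), corootSpace α : LieIdeal K H) := by
      rw [biSup_corootSpace_eq_top]; exact LieSubmodule.mem_top _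
    have hle : (⨆ α : Weight K H L, ⨆ (_ : α.IsNonZero), corootSpace α : LieIdeal K H).toSubmodule
        ≤ U.comap H.toSubmodule.subtype := by
      simp only [LieSubmodule.iSup_toSubmodule, iSup_le_iff]
      intro α hα y hy
      have := (mem_corootSpace α).mp hy
      refine (Submodule.span_le (p := U)).mpr ?_ this
      rintro _ ⟨y, hy, z, hz, rfl⟩
      exact h2 α hα y hy z hz
    exact hle hh
  have htop : (⨆ χ : Weight K H L, genWeightSpace L χ : LieSubmodule K H L) = ⊤ :=
    iSup_genWeightSpace_eq_top' K H L
  have := congrArg LieSubmodule.toSubmodule htop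
  rw [LieSubmodule.iSup_toSubmodule, LieSubmodule.top_toSubmodule] at this
  rw [eq_top_iff, ← this, iSup_le_iff]
  intro χ y hy
  by_cases hχ : χ.IsZero
  · have hy' : y ∈ rootSpace H (0 : H → K) := by rw [← hχ.eq]; exact hy
    rw [rootSpace_zero_eq K L H] at hy'
    exact hH ⟨y, hy'⟩
  · exact h1 χ hχ y hy

theorem LieAlgebra.IsKilling.lieSpan_setOf_isNilpotent_ad_eq_top
    (H : LieSubalgebra K L) [H.IsCartanSubalgebra] [IsTriangularizable K H L] :
    LieSubalgebra.lieSpan K L {e | IsNilpotent (ad K L e)} = ⊤ := by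
  rw [← LieSubalgebra.toSubmodule_inj, LieSubalgebra.top_toSubmodule]
  have hmem : ∀ α : H → K, α ≠ 0 → ∀ y ∈ rootSpace H α,
      y ∈ LieSubalgebra.lieSpan K L {e | IsNilpotent (ad K L e)} := fun α hα y hy =>
    LieSubalgebra.subset_lieSpan (isNilpotent_ad_of_mem_rootSpace H hα hy)
  refine eq_top_of_rootSpace_le H _ (fun α hα y hy => hmem α hα y hy)
    fun α hα y hy z hz => LieSubalgebra.lie_mem _ (hmem α hα y hy) (hmem (-α) ?_ z hz)
  exact neg_ne_zero.mpr hα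

omit [IsKilling K L] [IsTriangularizable K H L] in
theorem LieAlgebra.IsKilling.exists_forall_weight_apply_ne :
    ∃ h : H, (∀ α : Weight K H L, α.IsNonZero → α h ≠ 0) ∧
      ∀ α β : Weight K H L, α ≠ β → α h ≠ β h := by
  let f : {α : Weight K H L // α.IsNonZero} ⊕ {p : Weight K H L × Weight K H L // p.1 ≠ p.2} →
      Dual K H := Sum.elim (fun α => α.1.toLinear) fun p => p.1.1.toLinear - p.1.2.toLinear
  obtain ⟨h, hh⟩ := Dual.exists_forall_ne_zero_of_forall_exists f (by
    rintro (⟨α, hα⟩ | ⟨⟨α, β⟩, hαβ⟩)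
    · by_contra! hcon
      exact hα (funext hcon)
    · by_contra! hcon
      exact hαβ (Weight.ext fun h => sub_eq_zero.mp (hcon h)))
  exact ⟨h, fun α hα => hh (Sum.inl ⟨α, hα⟩),
    fun α β hαβ => sub_ne_zero.mp (hh (Sum.inr ⟨(α, β), hαβ⟩))⟩

end Cartan

open Polynomial in
theorem LieAlgebra.IsKilling.exists_span_adFamily_eq_top [IsAlgClosed K]
    {x : L} (hx : ∀ I : LieIdeal K L, x ∈ I → I = ⊤) :
    ∃ h : L, Submodule.span K (Set.range (adFamily (K := K) h x)) = ⊤ := by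
  classical
  obtain ⟨H, hH⟩ : ∃ H : LieSubalgebra K L, H.IsCartanSubalgebra :=
    let ⟨y, hy⟩ := exists_isCartanSubalgebra_engel K L
    ⟨_, hy⟩
  obtain ⟨h, hne, hsep⟩ := exists_forall_weight_apply_ne H
  let p : Weight K H L → K[X] := fun α => X * ∏ β ∈ Finset.univ.erase α, (X - C (β h))
  have hpα : ∀ α : Weight K H L, α.IsNonZero → (p α).eval (α h) ≠ 0 := by
    intro α hα
    simp only [p, eval_mul, eval_X, eval_prod, eval_sub, eval_C]
    refine mul_ne_zero (hne α hα) (Finset.prod_ne_zero_iff.mpr fun β hβ => ?_)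
    exact sub_ne_zero.mpr (hsep α β (Finset.ne_of_mem_erase hβ).symm)
  have hpβ : ∀ α β : Weight K H L, β ≠ α → (p α).eval (β h) = 0 := by
    intro α β hβ
    simp only [p, eval_mul, eval_X, eval_prod, eval_sub, eval_C]
    rw [Finset.prod_eq_zero (Finset.mem_erase.mpr ⟨hβ, Finset.mem_univ _⟩) (sub_self _), mul_zero]
  have hroot : ∀ (q : K[X]) (β : Weight K H L), ∀ y ∈ rootSpace H β,
      aeval (ad K L (h : L)) q y = q.eval (β h) • y := fun q β y hy =>
    Module.End.aeval_apply_of_mem_apply_eq_smul (lie_eq_smul_of_mem_rootSpace hy h)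
  have hQ : ∀ (α : Weight K H L) (y : L), aeval (ad K L (h : L)) (p α) y ∈ rootSpace H α := by
    intro α
    have htop := congrArg LieSubmodule.toSubmodule (iSup_genWeightSpace_eq_top' K H L)
    rw [LieSubmodule.iSup_toSubmodule, LieSubmodule.top_toSubmodule] at htop
    suffices ⊤ ≤ (rootSpace H α).toSubmodule.comap (aeval (ad K L (h : L)) (p α)) from
      fun y => this (Submodule.mem_top (x := y))
    rw [← htop, iSup_le_iff]
    intro β y hy
    rw [Submodule.mem_comap, hroot _ β y hy]
    by_cases hβ : β = α
    · subst hβ; exact Submodule.smul_mem _ _ hy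
    · rw [hpβ α β hβ, zero_smul]; exact Submodule.zero_mem _
  have hfun : ∀ α : {α : Weight K H L // α.IsNonZero},
      ∃ g : Dual K L, g ≠ 0 ∧ ∀ y, g y ≠ 0 → aeval (ad K L (h : L)) (p α) y ≠ 0 := by
    rintro ⟨α, hα⟩
    obtain ⟨e, he, he0⟩ := α.exists_ne_zero
    obtain ⟨f, hf⟩ : ∃ f : Dual K L, f e ≠ 0 := by
      by_contra! hcon
      exact he0 ((forall_dual_apply_eq_zero_iff K e).mp hcon)
    refine ⟨f ∘ₗ aeval (ad K L (h : L)) (p α), fun h0 => ?_, fun y hy h0 => hy ?_⟩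
    · have := LinearMap.congr_fun h0 e
      rw [LinearMap.comp_apply, hroot _ α e he, map_smul, LinearMap.zero_apply] at this
      exact smul_ne_zero (hpα α hα) hf this
    · rw [LinearMap.comp_apply, h0, map_zero]
  choose g hg0 hg using hfun
  obtain ⟨φ, hφ⟩ := exists_lieEquiv_forall_apply_ne_zero
    (lieSpan_setOf_isNilpotent_ad_eq_top H) hx g hg0 Finset.univ
  have hV : ∀ α : Weight K H L, α.IsNonZero → ∀ y ∈ rootSpace H α,
      y ∈ Submodule.span K (Set.range fun k => (ad K L (h : L) ^ (k + 1)) (φ x)) := by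
    intro α hα y hy
    have hw0 := hg ⟨α, hα⟩ _ (hφ ⟨α, hα⟩ (Finset.mem_univ _))
    have hw := hQ α (φ x)
    obtain ⟨c, hc⟩ := (finrank_eq_one_iff_of_nonzero' (V := rootSpace H α) ⟨_, hw⟩
      (by simpa using hw0)).mp (finrank_rootSpace_eq_one α hα) ⟨y, hy⟩
    have hc' : c • aeval (ad K L (h : L)) (p α) (φ x) = y := congrArg Subtype.val hc
    rw [← hc']
    refine Submodule.smul_mem _ _ ?_
    simp only [p]
    rw [mul_comm, map_mul, aeval_X, Module.End.mul_apply, aeval_eq_sum_range, LinearMap.sum_apply]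
    refine Submodule.sum_mem _ fun k _ => Submodule.smul_mem _ _ (Submodule.subset_span ⟨k, ?_⟩)
    exact LinearMap.congr_fun (pow_succ (ad K L (h : L)) k) (φ x)
  have htop : Submodule.span K (Set.range (adFamily (K := K) (h : L) (φ x))) = ⊤ := by
    refine eq_top_of_rootSpace_le H _ (fun α hα y hy => ?_) fun α hα y hy z hz => ?_
    · refine Submodule.span_mono ?_ (hV α hα y hy)
      rintro _ ⟨k, rfl⟩
      exact ⟨Sum.inl k, rfl⟩
    · have hz' := hV (-α) (Weight.IsNonZero.neg hα) z (by simpa using hz)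
      have hy' := hV α hα y hy
      have := Submodule.apply_mem_map₂ (LieModule.toEnd K L L : L →ₗ[K] Module.End K L) hy' hz'
      rw [Submodule.map₂_span_span] at this
      refine Submodule.span_mono ?_ this
      rintro _ ⟨_, ⟨i, rfl⟩, _, ⟨j, rfl⟩, rfl⟩
      exact ⟨Sum.inr (i, j), rfl⟩
  refine ⟨φ.symm h, ?_⟩
  simpa using span_adFamily_eq_top_of_lieEquiv φ.symm htop

end GenFamily

section Transfer

/-- `f` is polynomial in the coordinates of its argument. -/
def IsPolynomialMap {K n V : Type*} [Field K] [AddCommGroup V] [Module K V]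
    (f : (n → K) → V) : Prop :=
  ∀ g : Dual K V, ∃ p : MvPolynomial n K, ∀ v, g (f v) = MvPolynomial.eval v p

namespace IsPolynomialMap

variable {K n : Type*} [Field K]

theorem const {V : Type*} [AddCommGroup V] [Module K V] (z : V) :
    IsPolynomialMap fun _ : n → K => z :=
  fun g => ⟨MvPolynomial.C (g z), fun v => by simp⟩

theorem sum_smul [Fintype n] {V : Type*} [AddCommGroup V] [Module K V] (b : n → V) :
    IsPolynomialMap fun v : n → K => ∑ k, v k • b k :=
  fun g => ⟨∑ k, MvPolynomial.X k * MvPolynomial.C (g (b k)), fun v => by simp⟩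

variable {L : Type*} [LieRing L] [LieAlgebra K L] [FiniteDimensional K L]

theorem lie {f₁ f₂ : (n → K) → L} (h₁ : IsPolynomialMap f₁) (h₂ : IsPolynomialMap f₂) :
    IsPolynomialMap fun v => ⁅f₁ v, f₂ v⁆ := by
  intro g
  let b := finBasis K L
  choose p hp using fun i => h₁ (b.coord i)
  choose q hq using fun i => h₂ (b.coord i)
  refine ⟨∑ i, ∑ j, p i * q j * MvPolynomial.C (g ⁅b i, b j⁆), fun v => ?_⟩
  change g ⁅f₁ v, f₂ v⁆ = _
  conv_lhs => rw [← b.sum_repr (f₁ v), ← b.sum_repr (f₂ v)]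
  rw [sum_lie]
  simp only [lie_sum, map_sum, smul_lie, lie_smul, map_smul,
    smul_eq_mul, MvPolynomial.eval_mul, MvPolynomial.eval_C, ← hp, ← hq, Module.Basis.coord_apply]
  refine Finset.sum_congr rfl fun i _ => Finset.sum_congr rfl fun j _ => by ring

theorem adFamily {f : (n → K) → L} (hf : IsPolynomialMap f) (x : L) (i : ℕ ⊕ ℕ × ℕ) :
    IsPolynomialMap fun v => LieAlgebra.adFamily (K := K) (f v) x i := by
  have hpow : ∀ k : ℕ, IsPolynomialMap fun v => (ad K L (f v) ^ k) x := by
    intro k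
    induction k with
    | zero => exact const x
    | succ k ih =>
      convert hf.lie ih using 2 with v
      rw [pow_succ', Module.End.mul_apply, ad_apply]
  rcases i with k | p
  · exact hpow _
  · exact (hpow _).lie (hpow _)

end IsPolynomialMap

variable {F S : Type*} [Field F] [CharZero F] [LieRing S] [LieAlgebra F S] [FiniteDimensional F S]

omit [CharZero F] [FiniteDimensional F S] in
theorem LieAlgebra.tmul_adFamily (K : Type*) [Field K] [Algebra F K] (h x : S) (i : ℕ ⊕ ℕ × ℕ) :
    adFamily (K := K) ((1 : K) ⊗ₜ[F] h) (1 ⊗ₜ x) i = 1 ⊗ₜ adFamily (K := F) h x i := by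
  have hpow : ∀ k : ℕ, (ad K (K ⊗[F] S) (1 ⊗ₜ h) ^ k) (1 ⊗ₜ x) = 1 ⊗ₜ (ad F S h ^ k) x := by
    intro k
    induction k with
    | zero => simp
    | succ k ih =>
      rw [pow_succ', Module.End.mul_apply, ih, pow_succ', Module.End.mul_apply, ad_apply, ad_apply,
        ExtendScalars.bracket_tmul, one_mul]
  rcases i with k | p
  · exact hpow _
  · change ⁅_, _⁆ = 1 ⊗ₜ ⁅_, _⁆
    rw [hpow, hpow, ExtendScalars.bracket_tmul, one_mul]

theorem LieAlgebra.exists_span_adFamily_eq_top_of_tensorProduct (K : Type*) [Field K] [Algebra F K]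
    (x : S) {h : K ⊗[F] S}
    (hs : Submodule.span K (Set.range (adFamily (K := K) h ((1 : K) ⊗ₜ[F] x))) = ⊤) :
    ∃ h : S, Submodule.span F (Set.range (adFamily (K := F) h x)) = ⊤ := by
  classical
  let n := Fin (finrank F S)
  let b : Module.Basis n F S := finBasis F S
  let bK : Module.Basis n K (K ⊗[F] S) := b.baseChange K
  let f : (n → K) → K ⊗[F] S := fun v => ∑ k, v k • bK k
  have hf : IsPolynomialMap f := IsPolynomialMap.sum_smul _
  obtain ⟨κ, a, -, hspan, hli⟩ :=
    exists_linearIndependent' K (adFamily (K := K) h ((1 : K) ⊗ₜ[F] x))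
  let B : Module.Basis κ K (K ⊗[F] S) := Module.Basis.mk hli (by rw [hspan, hs])
  let a' : n → ℕ ⊕ ℕ × ℕ := a ∘ (B.indexEquiv bK).symm
  choose P hP using fun j k => hf.adFamily ((1 : K) ⊗ₜ[F] x) (a' k) (bK.coord j)
  let D : MvPolynomial n K := (Matrix.of P).det
  have hD : ∀ v, MvPolynomial.eval v D =
      bK.det (fun k => adFamily (K := K) (f v) ((1 : K) ⊗ₜ[F] x) (a' k)) := by
    intro v
    rw [Module.Basis.det_apply, RingHom.map_det]
    congr 1
    ext j k
    exact (hP j k v).symm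
  have hD0 : D ≠ 0 := by
    intro h0
    have h1 := hD (bK.repr h)
    have h2 : f (bK.repr h) = h := bK.sum_repr h
    rw [h0, map_zero, h2] at h1
    let B' := B.reindex (B.indexEquiv bK)
    have h3 : (fun k => adFamily (K := K) h ((1 : K) ⊗ₜ[F] x) (a' k)) = B' := by
      funext k
      simp [B', B, a']
    rw [h3] at h1
    exact (bK.isUnit_det B').ne_zero h1.symm
  obtain ⟨c, hc⟩ : ∃ c : n → F, MvPolynomial.eval (fun k => algebraMap F K (c k)) D ≠ 0 := by
    by_contra! hcon
    refine hD0 (MvPolynomial.funext_set (fun _ => Set.range (algebraMap F K))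
      (fun _ => Set.infinite_range_of_injective (algebraMap F K).injective) fun v hv => ?_)
    choose c hc using fun k => hv k (Set.mem_univ k)
    rw [map_zero, ← hcon c]
    rw [show v = fun k => algebraMap F K (c k) from funext fun k => (hc k).symm]
  refine ⟨∑ k, c k • b k, ?_⟩
  have hfc : f (fun k => algebraMap F K (c k)) = (1 : K) ⊗ₜ[F] ∑ k, c k • b k := by
    simp [f, bK, TensorProduct.tmul_sum, TensorProduct.smul_tmul', Algebra.algebraMap_eq_smul_one]
  have hdet : bK.det (fun k => adFamily (K := K) (f fun k => algebraMap F K (c k))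
      ((1 : K) ⊗ₜ[F] x) (a' k)) =
      algebraMap F K (b.det fun k => adFamily (K := F) (∑ k, c k • b k) x (a' k)) := by
    rw [Module.Basis.det_apply, Module.Basis.det_apply, RingHom.map_det]
    congr 1
    ext j k
    rw [Module.Basis.toMatrix_apply, hfc, tmul_adFamily, Module.Basis.baseChange_repr_tmul,
      RingHom.mapMatrix_apply, Matrix.map_apply, Module.Basis.toMatrix_apply, Algebra.smul_def, mul_one]
  rw [hD, hdet] at hc
  have hu : IsUnit (b.det fun k => adFamily (K := F) (∑ k, c k • b k) x (a' k)) :=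
    isUnit_iff_ne_zero.mpr fun h0 => hc (by rw [h0, map_zero])
  have := (Module.Basis.is_basis_iff_det b).mpr hu
  rw [eq_top_iff, ← this.2]
  refine Submodule.span_mono ?_
  rintro _ ⟨k, rfl⟩
  exact ⟨a' k, rfl⟩

omit [CharZero F] in
theorem LieAlgebra.IsKilling.tensorProduct (K : Type*) [Field K] [Algebra F K] [IsKilling F S] :
    IsKilling K (K ⊗[F] S) where
  killingCompl_top_eq_bot := by
    classical
    rw [eq_bot_iff]
    intro y hy
    rw [LieIdeal.mem_killingCompl] at hy
    let b : Module.Basis (Fin (finrank F S)) F S := finBasis F S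
    have hnd : (killingForm F S).Nondegenerate := killingForm_nondegenerate F S
    let b' := LinearMap.BilinForm.dualBasis (killingForm F S) hnd b
    have hbb : ∀ i j, traceForm F S S (b i) (b' j) = if i = j then 1 else 0 := fun i j => by
      rw [LieModule.traceForm_comm, LinearMap.BilinForm.apply_dualBasis_left]
    let bK : Module.Basis _ K (K ⊗[F] S) := b.baseChange K
    rw [LieSubmodule.mem_bot, ← bK.forall_coord_eq_zero_iff]
    intro j
    have h := hy ((1 : K) ⊗ₜ b' j) (LieSubmodule.mem_top _)
    rw [LieModule.traceForm_comm, ← bK.sum_repr y, LieModule.traceForm_baseChange] at h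
    simp only [map_sum, LinearMap.sum_apply, map_smul, LinearMap.smul_apply] at h
    rw [Finset.sum_eq_single j] at h
    · simpa [bK, hbb] using h
    · intro i _ hij
      simp [bK, hbb, hij]
    · simp

theorem LieAlgebra.exists_span_adFamily_eq_top_of_isSimple [IsSimple F S] {x : S} (hx : x ≠ 0) :
    ∃ h : S, Submodule.span F (Set.range (adFamily (K := F) h x)) = ⊤ := by
  let K := AlgebraicClosure F
  have : CharZero K := charZero_of_injective_algebraMap (algebraMap F K).injective
  have : IsKilling K (K ⊗[F] S) := IsKilling.tensorProduct K
  obtain ⟨h, hh⟩ := IsKilling.exists_span_adFamily_eq_top (K := K) (L := K ⊗[F] S)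
    (x := 1 ⊗ₜ x) (fun I hI => by
      let J : LieIdeal F S :=
        { carrier := {s | (1 : K) ⊗ₜ[F] s ∈ I}
          add_mem' := fun {a b} ha hb => by
            change _ ∈ I
            rw [TensorProduct.tmul_add]; exact I.add_mem ha hb
          zero_mem' := by
            change _ ∈ I
            rw [TensorProduct.tmul_zero]; exact I.zero_mem
          smul_mem' := fun r a ha => by
            change _ ∈ I
            rw [← TensorProduct.smul_tmul, Algebra.smul_def, ← smul_eq_mul,
              ← TensorProduct.smul_tmul']
            exact I.smul_mem _ ha
          lie_mem := fun {y s} hs => by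
            have := lie_mem_right K _ I ((1 : K) ⊗ₜ[F] y) _ hs
            rwa [ExtendScalars.bracket_tmul, one_mul] at this }
      have hJ : J = ⊤ := (IsSimple.eq_bot_or_eq_top J).resolve_left fun h0 =>
        hx (by
          have : x ∈ J := hI
          rwa [h0, LieSubmodule.mem_bot] at this)
      rw [eq_top_iff]
      intro z _
      induction z with
      | zero => exact I.zero_mem
      | add a b ha hb => exact I.add_mem (ha trivial) (hb trivial)
      | tmul k s =>
        have hs : s ∈ J := by rw [hJ]; exact LieSubmodule.mem_top _
        have := I.smul_mem k (show (1 : K) ⊗ₜ[F] s ∈ I from hs)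
        rwa [TensorProduct.smul_tmul', smul_eq_mul, mul_one] at this)
  exact exists_span_adFamily_eq_top_of_tensorProduct K x hh

theorem LieAlgebra.exists_isCoatom_notMem_of_isSimple [IsSimple F S] {x : S} (hx : x ≠ 0) :
    ∃ M : LieSubalgebra F S, IsCoatom M ∧ x ∉ M := by
  obtain ⟨h, hh⟩ := exists_span_adFamily_eq_top_of_isSimple (F := F) hx
  let A : LieSubalgebra F S :=
    { F ∙ h with
      lie_mem' := fun {a b} ha hb => by
        obtain ⟨r, rfl⟩ := Submodule.mem_span_singleton.mp ha
        obtain ⟨s, rfl⟩ := Submodule.mem_span_singleton.mp hb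
        simp }
  have hA : A ≠ ⊤ := by
    intro hA
    refine IsSimple.non_abelian F (L := S) ⟨fun a b => ?_⟩
    have ha : a ∈ A := by rw [hA]; exact LieSubalgebra.mem_top a
    have hb : b ∈ A := by rw [hA]; exact LieSubalgebra.mem_top b
    obtain ⟨r, rfl⟩ := Submodule.mem_span_singleton.mp ha
    obtain ⟨s, rfl⟩ := Submodule.mem_span_singleton.mp hb
    simp
  obtain ⟨M, hM, hAM⟩ := (eq_top_or_exists_le_coatom A).resolve_left hA
  refine ⟨M, hM, fun hxM => hM.1 ?_⟩
  have hhM : h ∈ M := hAM (Submodule.mem_span_singleton_self h)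
  have hpow : ∀ k : ℕ, (ad F S h ^ k) x ∈ M := by
    intro k
    induction k with
    | zero => exact hxM
    | succ k ih =>
      rw [pow_succ', Module.End.mul_apply, ad_apply]
      exact M.lie_mem hhM ih
  rw [← LieSubalgebra.toSubmodule_inj, LieSubalgebra.top_toSubmodule, eq_top_iff, ← hh,
    Submodule.span_le]
  rintro _ ⟨i, rfl⟩
  rcases i with k | p
  · exact hpow _
  · exact M.lie_mem (hpow _) (hpow _)

end Transfer

section Supplement

variable {F L : Type*} [Field F] [LieRing L] [LieAlgebra F L]

/-- The sum of a subalgebra and an ideal. -/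
def LieSubalgebra.addIdeal (U : LieSubalgebra F L) (A : LieIdeal F L) : LieSubalgebra F L where
  carrier := {x | ∃ u ∈ U, x - u ∈ A}
  add_mem' := by
    rintro x y ⟨u, hu, hx⟩ ⟨v, hv, hy⟩
    exact ⟨u + v, U.add_mem hu hv, by simpa [add_sub_add_comm] using A.add_mem hx hy⟩
  zero_mem' := ⟨0, U.zero_mem, by simp⟩
  smul_mem' := by
    rintro c x ⟨u, hu, hx⟩
    exact ⟨c • u, U.smul_mem c hu, by simpa [smul_sub] using A.smul_mem c hx⟩
  lie_mem' := by
    rintro x y ⟨u, hu, hx⟩ ⟨v, hv, hy⟩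
    refine ⟨⁅u, v⁆, U.lie_mem hu hv, ?_⟩
    have h : ⁅x, y⁆ - ⁅u, v⁆ = ⁅x - u, y⁆ + ⁅u, y - v⁆ := by simp
    rw [h]
    exact A.add_mem (lie_mem_left F L A _ _ hx) (lie_mem_right F L A _ _ hy)

theorem LieSubalgebra.mem_addIdeal {U : LieSubalgebra F L} {A : LieIdeal F L} {x : L} :
    x ∈ U.addIdeal A ↔ ∃ u ∈ U, x - u ∈ A := Iff.rfl

theorem LieSubalgebra.le_addIdeal (U : LieSubalgebra F L) (A : LieIdeal F L) :
    U ≤ U.addIdeal A := fun x hx => ⟨x, hx, by simp⟩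

theorem LieSubalgebra.mem_addIdeal_of_mem (U : LieSubalgebra F L) {A : LieIdeal F L} {x : L}
    (hx : x ∈ A) : x ∈ U.addIdeal A := ⟨0, U.zero_mem, by simpa⟩

/-- A subalgebra `U` supplements an ideal `A` if `U + A` is the whole Lie algebra. -/
def LieSubalgebra.Supplements (U : LieSubalgebra F L) (A : LieIdeal F L) : Prop :=
  ∀ x : L, ∃ u ∈ U, x - u ∈ A

theorem LieSubalgebra.supplements_of_isCoatom {M : LieSubalgebra F L} (hM : IsCoatom M)
    {A : LieIdeal F L} {a : L} (ha : a ∈ A) (haM : a ∉ M) : M.Supplements A := by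
  have h : M.addIdeal A = ⊤ := hM.2 _ (lt_of_le_of_ne (M.le_addIdeal A) fun h =>
    haM (h ▸ M.mem_addIdeal_of_mem ha))
  intro x
  have hx : x ∈ M.addIdeal A := h ▸ LieSubalgebra.mem_top x
  exact hx

/-- The intersection with an abelian ideal of a supplement to it is again an ideal. -/
def LieSubalgebra.Supplements.idealInf {U : LieSubalgebra F L} {A : LieIdeal F L}
    (hU : U.Supplements A) (hA : ∀ x ∈ A, ∀ y ∈ A, ⁅x, y⁆ = 0) : LieIdeal F L :=
  { carrier := {x | x ∈ U ∧ x ∈ A}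
    add_mem' := fun hx hy => ⟨U.add_mem hx.1 hy.1, A.add_mem hx.2 hy.2⟩
    zero_mem' := ⟨U.zero_mem, A.zero_mem⟩
    smul_mem' := fun c _ hx => ⟨U.smul_mem c hx.1, A.smul_mem c hx.2⟩
    lie_mem := fun {x y} hy => by
      refine ⟨?_, A.lie_mem hy.2⟩
      obtain ⟨u, hu, hx⟩ := hU x
      have h : ⁅x, y⁆ = ⁅u, y⁆ := by
        rw [← sub_eq_zero, ← sub_lie]
        exact hA _ hx _ hy.2
      rw [h]
      exact U.lie_mem hu hy.1 }

/-- If each nonzero ideal `B` inside the abelian ideal `A` has a supplement that does not contain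
it, then `A` has a complement. -/
theorem LieSubalgebra.exists_supplements_disjoint [FiniteDimensional F L] {A : LieIdeal F L}
    (hA : ∀ x ∈ A, ∀ y ∈ A, ⁅x, y⁆ = 0)
    (h : ∀ B ≤ A, B ≠ ⊥ → ∃ M : LieSubalgebra F L, M.Supplements B ∧ ∃ b ∈ B, b ∉ M) :
    ∃ U : LieSubalgebra F L, U.Supplements A ∧ ∀ x ∈ U, x ∈ A → x = 0 := by
  obtain ⟨U, hU, hmin⟩ := (measure fun U : LieSubalgebra F L => finrank F U).wf.has_min
    {U | U.Supplements A} ⟨⊤, fun x => ⟨x, LieSubalgebra.mem_top x, by simp⟩⟩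
  refine ⟨U, hU, fun x hxU hxA => ?_⟩
  by_contra hx
  obtain ⟨M, hM, b, hb, hbM⟩ := h (hU.idealInf hA) (fun y hy => hy.2)
    (fun hB => hx (by
      have : x ∈ hU.idealInf hA := ⟨hxU, hxA⟩
      rwa [hB] at this))
  have hMU : (M ⊓ U).Supplements A := by
    intro y
    obtain ⟨u, hu, hyu⟩ := hU y
    obtain ⟨m, hm, hum⟩ := hM u
    refine ⟨m, (LieSubalgebra.mem_inf _ _ _).mpr ⟨hm, ?_⟩, ?_⟩
    · have := U.sub_mem hu hum.1
      rwa [sub_sub_cancel] at this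
    · have := A.add_mem hyu hum.2
      rwa [sub_add_sub_cancel] at this
  refine hmin _ hMU (Submodule.finrank_lt_finrank_of_lt (lt_of_le_of_ne ?_ fun he => ?_))
  · exact fun y hy => ((LieSubalgebra.mem_inf _ _ _).mp hy).2
  · have hbU : b ∈ (M ⊓ U).toSubmodule := he ▸ hb.1
    exact hbM ((LieSubalgebra.mem_inf _ _ _).mp hbU).1

end Supplement

section AbelianSocle

variable {F L : Type*} [Field F] [LieRing L] [LieAlgebra F L]

theorem LieIdeal.le_ker_comm {I J : LieIdeal F L} :
    I ≤ LieModule.ker F L J ↔ J ≤ LieModule.ker F L I := by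
  have key : ∀ I J : LieIdeal F L, I ≤ LieModule.ker F L J → J ≤ LieModule.ker F L I := by
    intro I J h x hx
    rw [LieModule.mem_ker]
    intro y
    have := (LieModule.mem_ker F L J (y : L)).mp (h y.2) ⟨x, hx⟩
    have h' : ⁅(y : L), x⁆ = 0 := congrArg Subtype.val this
    apply Subtype.ext
    change ⁅x, (y : L)⁆ = 0
    rw [← lie_skew, h', neg_zero]
  exact ⟨key I J, key J I⟩

theorem LieIdeal.mem_ker_iff {I : LieIdeal F L} {x : L} :
    x ∈ LieModule.ker F L I ↔ ∀ y ∈ I, ⁅x, y⁆ = 0 := by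
  rw [LieModule.mem_ker]
  exact ⟨fun h y hy => congrArg Subtype.val (h ⟨y, hy⟩), fun h y => Subtype.ext (h y y.2)⟩

variable (F L) in
/-- The abelian socle, the join of the minimal abelian ideals. -/
def LieAlgebra.abelianSocle : LieIdeal F L := sSup {I : LieIdeal F L | IsAtom I ∧ IsLieAbelian I}

theorem LieAlgebra.abelianSocle_lie_eq_zero :
    ∀ x ∈ abelianSocle F L, ∀ y ∈ abelianSocle F L, ⁅x, y⁆ = 0 := by
  suffices h : abelianSocle F L ≤ LieModule.ker F L (abelianSocle F L) from
    fun x hx => LieIdeal.mem_ker_iff.mp (h hx)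
  refine sSup_le fun I hI => LieIdeal.le_ker_comm.mp (sSup_le fun J hJ => ?_)
  intro x hx
  rw [LieIdeal.mem_ker_iff]
  intro y hy
  by_cases hIJ : I = J
  · subst hIJ
    exact LieIdeal.isLieAbelian_iff_lie_eq_zero.mp hI.2 x hx y hy
  · have := hI.1.disjoint_of_ne hJ.1 hIJ
    rw [disjoint_iff] at this
    have hmem : ⁅x, y⁆ ∈ I ⊓ J := by
      rw [LieSubmodule.mem_inf]
      exact ⟨I.lie_mem hy, lie_mem_left F L J _ _ hx⟩
    rw [this] at hmem
    exact hmem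

variable [FiniteDimensional F L]

theorem LieIdeal.le_radical_of_isLieAbelian {I : LieIdeal F L} (h : IsLieAbelian I) :
    I ≤ radical F L := by
  refine le_radical_of_lie_le ?_
  rw [LieSubmodule.lie_abelian_iff_lie_self_eq_bot] at h
  rw [h]
  exact bot_le

theorem LieAlgebra.abelianSocle_le_radical : abelianSocle F L ≤ radical F L :=
  sSup_le fun _ hI => LieIdeal.le_radical_of_isLieAbelian hI.2

theorem LieIdeal.isLieAbelian_of_isAtom {I : LieIdeal F L} (hI : IsAtom I)
    (h : I ≤ radical F L) : IsLieAbelian I := by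
  rw [LieSubmodule.lie_abelian_iff_lie_self_eq_bot]
  refine (hI.le_iff.mp (LieSubmodule.lie_le_left I I)).resolve_right fun he => ?_
  have hs : IsSolvable I := (LieIdeal.solvable_iff_le_radical F L I).mpr h
  obtain ⟨k, hk⟩ := (LieAlgebra.isSolvable_iff F I).mp hs
  rw [LieIdeal.derivedSeries_eq_bot_iff] at hk
  have hconst : ∀ n, derivedSeriesOfIdeal F L n I = I := by
    intro n
    induction n with
    | zero => rfl
    | succ n ih => rw [derivedSeriesOfIdeal_succ, ih, he]
  exact hI.1 (by rw [← hconst k, hk])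

theorem LieAlgebra.le_abelianSocle_of_isAtom {I : LieIdeal F L} (hI : IsAtom I)
    (h : I ≤ radical F L) : I ≤ abelianSocle F L :=
  le_sSup ⟨hI, LieIdeal.isLieAbelian_of_isAtom hI h⟩

theorem LieIdeal.exists_isAtom_le {I : LieIdeal F L} (hI : I ≠ ⊥) : ∃ J ≤ I, IsAtom J := by
  have := LieSubmodule.wellFoundedLT_of_isArtinian F L L
  obtain ⟨J, hJ, hJI⟩ := (eq_bot_or_exists_atom_le I).resolve_left hI
  exact ⟨J, hJI, hJ⟩

end AbelianSocle

section Forward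

variable {F L : Type*} [Field F] [LieRing L] [LieAlgebra F L] [FiniteDimensional F L]

theorem LieSubalgebra.exists_supplements_disjoint_of_frattini
    (hφ : ∀ x : L, x ≠ 0 → ∃ M : LieSubalgebra F L, IsCoatom M ∧ x ∉ M) {A : LieIdeal F L}
    (hA : ∀ x ∈ A, ∀ y ∈ A, ⁅x, y⁆ = 0) :
    ∃ U : LieSubalgebra F L, U.Supplements A ∧ ∀ x ∈ U, x ∈ A → x = 0 := by
  refine exists_supplements_disjoint hA fun B _ hB => ?_
  obtain ⟨b, hb, hb0⟩ : ∃ b ∈ B, b ≠ 0 := by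
    by_contra! h
    exact hB ((LieSubmodule.eq_bot_iff B).mpr h)
  obtain ⟨M, hM, hbM⟩ := hφ b hb0
  exact ⟨M, supplements_of_isCoatom hM hb hbM, b, hb, hbM⟩

theorem LieAlgebra.radical_inf_ker_le_abelianSocle
    (hφ : ∀ x : L, x ≠ 0 → ∃ M : LieSubalgebra F L, IsCoatom M ∧ x ∉ M) :
    radical F L ⊓ LieModule.ker F L (abelianSocle F L) ≤ abelianSocle F L := by
  set A := abelianSocle F L
  have hA : ∀ x ∈ A, ∀ y ∈ A, ⁅x, y⁆ = 0 := abelianSocle_lie_eq_zero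
  obtain ⟨U, hU, hdisj⟩ := LieSubalgebra.exists_supplements_disjoint_of_frattini hφ hA
  let T : LieIdeal F L :=
    { carrier := {t | t ∈ U ∧ t ∈ radical F L ⊓ LieModule.ker F L A}
      add_mem' := fun hx hy => ⟨U.add_mem hx.1 hy.1, add_mem hx.2 hy.2⟩
      zero_mem' := ⟨U.zero_mem, zero_mem _⟩
      smul_mem' := fun c _ hx => ⟨U.smul_mem c hx.1, SMulMemClass.smul_mem c hx.2⟩
      lie_mem := fun {x t} ht => by
        refine ⟨?_, LieSubmodule.lie_mem _ ht.2⟩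
        obtain ⟨u, hu, hx⟩ := hU x
        have h : ⁅x, t⁆ = ⁅u, t⁆ := by
          rw [← sub_eq_zero, ← sub_lie, ← lie_skew,
            LieIdeal.mem_ker_iff.mp ((LieSubmodule.mem_inf _ _ _).mp ht.2).2 _ hx, neg_zero]
        rw [h]
        exact U.lie_mem hu ht.1 }
  have hT : T = ⊥ := by
    by_contra hT
    obtain ⟨I, hIT, hI⟩ := LieIdeal.exists_isAtom_le hT
    have hIA : I ≤ A := le_abelianSocle_of_isAtom hI fun x hx =>
      ((LieSubmodule.mem_inf _ _ _).mp (hIT hx).2).1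
    refine hI.1 ((LieSubmodule.eq_bot_iff I).mpr fun x hx => hdisj x (hIT hx).1 (hIA hx))
  intro x hx
  obtain ⟨u, hu, hxu⟩ := hU x
  have hAle : A ≤ radical F L ⊓ LieModule.ker F L A :=
    le_inf abelianSocle_le_radical fun x hx => LieIdeal.mem_ker_iff.mpr (hA x hx)
  have huT : u ∈ T := ⟨hu, by
    have := sub_mem hx (hAle hxu)
    rwa [sub_sub_cancel] at this⟩
  rw [hT, LieSubmodule.mem_bot] at huT
  rwa [huT, sub_zero] at hxu

theorem LieAlgebra.lie_radical_le_abelianSocle [CharZero F]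
    (hφ : ∀ x : L, x ≠ 0 → ∃ M : LieSubalgebra F L, IsCoatom M ∧ x ∉ M) :
    ⁅(⊤ : LieIdeal F L), radical F L⁆ ≤ abelianSocle F L := by
  refine le_trans (le_inf (LieSubmodule.lie_le_right _ _) (LieIdeal.le_ker_comm.mp ?_))
    (radical_inf_ker_le_abelianSocle hφ)
  refine sSup_le fun I hI => LieIdeal.le_ker_comm.mp fun n hn => ?_
  have := LieSubmodule.isIrreducible_of_isAtom hI.1
  rw [LieModule.mem_ker]
  exact lie_radical_lie_eq_zero (F := F) n hn

theorem LieAlgebra.lie_radical_inf_center_eq_bot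
    (hφ : ∀ x : L, x ≠ 0 → ∃ M : LieSubalgebra F L, IsCoatom M ∧ x ∉ M) :
    ⁅(⊤ : LieIdeal F L), radical F L⁆ ⊓ center F L = ⊥ := by
  set J := ⁅(⊤ : LieIdeal F L), radical F L⁆
  have hZ : ∀ z ∈ J ⊓ center F L, ∀ y : L, ⁅y, z⁆ = 0 := fun z hz =>
    (LieModule.mem_maxTrivSubmodule F L L z).mp ((LieSubmodule.mem_inf _ _ _).mp hz).2
  obtain ⟨U, hU, hdisj⟩ := LieSubalgebra.exists_supplements_disjoint_of_frattini hφ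
    (A := J ⊓ center F L) fun x _ y hy => hZ y hy x
  have hlie : ∀ x y : L, ⁅x, y⁆ ∈ U := by
    intro x y
    obtain ⟨u, hu, hxu⟩ := hU x
    obtain ⟨v, hv, hyv⟩ := hU y
    have h : ⁅x, y⁆ = ⁅u, v⁆ := by
      have h1 := hZ _ hxu y
      have h2 := hZ _ hyv u
      rw [lie_sub, sub_eq_zero] at h1 h2
      rw [← lie_skew, h1, lie_skew, h2]
    rw [h]
    exact U.lie_mem hu hv
  have hJ : J.toSubmodule ≤ U.toSubmodule := by
    rw [LieSubmodule.lieIdeal_oper_eq_linear_span', Submodule.span_le]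
    rintro _ ⟨x, _, y, _, rfl⟩
    exact hlie x y
  rw [LieSubmodule.eq_bot_iff]
  exact fun x hx => hdisj x (hJ ((LieSubmodule.mem_inf _ _ _).mp hx).1) hx

end Forward

section FrattiniLeRadical

variable {F L L' : Type*} [Field F] [LieRing L] [LieAlgebra F L] [LieRing L'] [LieAlgebra F L']

theorem LieSubalgebra.isCoatom_comap {f : L →ₗ⁅F⁆ L'} (hf : Function.Surjective f)
    {M : LieSubalgebra F L'} (hM : IsCoatom M) : IsCoatom (M.comap f) := by
  refine ⟨fun h => hM.1 ?_, fun K hK => ?_⟩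
  · rw [eq_top_iff]
    intro y _
    obtain ⟨x, rfl⟩ := hf y
    have hx : x ∈ M.comap f := h ▸ LieSubalgebra.mem_top x
    exact hx
  · obtain ⟨hle, k, hk, hkM⟩ := SetLike.lt_iff_le_and_exists.mp hK
    have hlt : M < K.map f := by
      refine SetLike.lt_iff_le_and_exists.mpr ⟨fun y hy => ?_, f k, ⟨k, hk, rfl⟩, hkM⟩
      obtain ⟨x, rfl⟩ := hf y
      exact ⟨x, hle hy, rfl⟩
    rw [eq_top_iff]
    intro y _
    have hy : f y ∈ K.map f := hM.2 _ hlt ▸ LieSubalgebra.mem_top (f y)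
    obtain ⟨x, hx, hxy⟩ := hy
    have hyx : y - x ∈ M.comap f := by
      change f (y - x) ∈ M
      have hxy : f x = f y := hxy
      rw [map_sub, hxy, sub_self]
      exact M.zero_mem
    have := K.add_mem (hle hyx) hx
    rwa [sub_add_cancel] at this

theorem LieIdeal.isSimple_quotient {N : LieIdeal F L} (hN : IsCoatom N)
    (h : ¬ ∀ x y : L, ⁅x, y⁆ ∈ N) : IsSimple F (L ⧸ N) where
  eq_bot_or_eq_top I := by
    have hle : N ≤ I.comap N.quotientHom := fun x hx => by
      rw [LieIdeal.mem_comap, LieIdeal.quotientHom_eq_zero.mpr hx]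
      exact I.zero_mem
    rcases hle.eq_or_lt with he | hlt
    · left
      rw [LieSubmodule.eq_bot_iff]
      intro y hy
      obtain ⟨x, rfl⟩ := N.quotientHom_surjective y
      rw [LieIdeal.quotientHom_eq_zero, he]
      exact LieIdeal.mem_comap.mpr hy
    · right
      have ht := hN.2 _ hlt
      rw [eq_top_iff]
      intro y _
      obtain ⟨x, rfl⟩ := N.quotientHom_surjective y
      rw [← LieIdeal.mem_comap, ht]
      exact LieSubmodule.mem_top x
  non_abelian ha := h fun x y => by
    rw [← LieIdeal.quotientHom_eq_zero, LieHom.map_lie]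
    exact ha.trivial _ _

variable [FiniteDimensional F L]

theorem LieAlgebra.exists_isCoatom_notMem_of_hasTrivialRadical [CharZero F]
    [HasTrivialRadical F L] {x : L} (hx : x ≠ 0) :
    ∃ M : LieSubalgebra F L, IsCoatom M ∧ x ∉ M := by
  have : IsSemisimple F L := inferInstance
  let X : LieIdeal F L := LieSubmodule.lieSpan F L {x}
  have hxX : x ∈ X := LieSubmodule.subset_lieSpan (Set.mem_singleton x)
  obtain ⟨I, hIX, hI⟩ := LieIdeal.exists_isAtom_le (I := X) fun h => hx (by
    rwa [h, LieSubmodule.mem_bot] at hxX)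
  have hcoatom : IsCoatom Iᶜ := (isCompl_compl (x := I)).isAtom_iff_isCoatom.mp hI
  have hxN : x ∉ Iᶜ := fun h => hI.1 <| by
    have hle : I ≤ Iᶜ := hIX.trans (LieSubmodule.lieSpan_le.mpr (Set.singleton_subset_iff.mpr h))
    simpa using hle
  have := LieIdeal.isSimple_quotient hcoatom fun h => hcoatom.1 <| by
    rw [eq_top_iff, ← LieIdeal.lie_self_eq_of_hasTrivialRadical (F := F) (⊤ : LieIdeal F L),
      LieSubmodule.lie_le_iff]
    exact fun x _ y _ => h x y
  have hx' : (Iᶜ).quotientHom x ≠ 0 := fun h => hxN (LieIdeal.quotientHom_eq_zero.mp h)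
  obtain ⟨M, hM, hxM⟩ := exists_isCoatom_notMem_of_isSimple (F := F) hx'
  exact ⟨_, LieSubalgebra.isCoatom_comap (LieIdeal.quotientHom_surjective _) hM, hxM⟩

theorem LieAlgebra.exists_isCoatom_notMem_of_notMem_radical [CharZero F] {x : L}
    (hx : x ∉ radical F L) : ∃ M : LieSubalgebra F L, IsCoatom M ∧ x ∉ M := by
  have hx' : (radical F L).quotientHom x ≠ 0 := fun h => hx (LieIdeal.quotientHom_eq_zero.mp h)
  obtain ⟨M, hM, hxM⟩ := exists_isCoatom_notMem_of_hasTrivialRadical (F := F) hx'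
  exact ⟨_, LieSubalgebra.isCoatom_comap (LieIdeal.quotientHom_surjective _) hM, hxM⟩

omit [FiniteDimensional F L] in
theorem LieAlgebra.exists_isCoatom_notMem_of_apply_lie_eq_zero {g : L →ₗ[F] F}
    (hg : ∀ x y : L, g ⁅x, y⁆ = 0) {x : L} (hx : g x ≠ 0) :
    ∃ M : LieSubalgebra F L, IsCoatom M ∧ x ∉ M := by
  let M : LieSubalgebra F L := { LinearMap.ker g with lie_mem' := fun {a b} _ _ => hg a b }
  have hmem : ∀ y, y ∈ M ↔ g y = 0 := fun y => Iff.rfl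
  refine ⟨M, ⟨fun h => hx ((hmem x).mp (h ▸ LieSubalgebra.mem_top x)), fun K hK => ?_⟩, hx⟩
  obtain ⟨hle, k, hk, hkM⟩ := SetLike.lt_iff_le_and_exists.mp hK
  rw [hmem] at hkM
  rw [eq_top_iff]
  intro y _
  have hy : y - (g y / g k) • k ∈ M := by
    rw [hmem, map_sub, map_smul, smul_eq_mul, div_mul_cancel₀ _ hkM, sub_self]
  have := K.add_mem (hle hy) (K.smul_mem (g y / g k) hk)
  rwa [sub_add_cancel] at this

theorem LieAlgebra.exists_isCoatom_notMem_of_notMem_lie_radical [CharZero F] {x : L}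
    (hxR : x ∈ radical F L) (hx : x ∉ ⁅(⊤ : LieIdeal F L), radical F L⁆) :
    ∃ M : LieSubalgebra F L, IsCoatom M ∧ x ∉ M := by
  set J := ⁅(⊤ : LieIdeal F L), radical F L⁆
  have hJ : ∀ y : L, ∀ r ∈ radical F L, ⁅y, r⁆ ∈ J := fun y r hr =>
    LieSubmodule.lie_mem_lie (LieSubmodule.mem_top y) hr
  let ann (N : LieIdeal F L) : LieSubmodule F L (L →ₗ[F] F) :=
    { carrier := {f | ∀ n ∈ N, f n = 0}
      add_mem' := fun hf hg n hn => by simp [hf n hn, hg n hn]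
      zero_mem' := fun n _ => rfl
      smul_mem' := fun c f hf n hn => by simp [hf n hn]
      lie_mem := fun {y f} hf n hn => by
        rw [Module.Dual.lie_apply, hf _ (N.lie_mem hn), neg_zero] }
  obtain ⟨f, hfx, hfJ⟩ := Submodule.exists_le_ker_of_notMem (p := J.toSubmodule) hx
  obtain ⟨w, hw, h⟩ := LieModule.exists_sub_lie_mem F (A := ⊥) (W := ann (radical F L))
    (B := ann J) bot_le (fun g hg n hn => hg n (LieSubmodule.lie_le_right _ _ hn))
    (fun r hr g hg => by
      rw [LieSubmodule.mem_bot]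
      ext z
      rw [Module.Dual.lie_apply, ← lie_skew, map_neg, hg _ (hJ z r hr)]
      simp)
    (fun y g hg n hn => by
      rw [Module.Dual.lie_apply, hg _ (hJ y n hn), neg_zero]) (b := f) fun n hn => hfJ hn
  refine exists_isCoatom_notMem_of_apply_lie_eq_zero (g := f - w) (fun y z => ?_) (x := x) ?_
  · have := LinearMap.congr_fun ((LieSubmodule.mem_bot _).mp (h y)) z
    rw [Module.Dual.lie_apply] at this
    simpa only [LinearMap.zero_apply, neg_eq_zero] using this
  · rwa [LinearMap.sub_apply, hw x hxR, sub_zero]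

end FrattiniLeRadical

section Backward

variable {F L : Type*} [Field F] [LieRing L] [LieAlgebra F L] {I I' : LieIdeal F L}

theorem LieIdeal.eq_zero_of_disjoint (hd : Disjoint I I') {x : L} (hx : x ∈ I) (hx' : x ∈ I') :
    x = 0 := by
  have h : x ∈ I ⊓ I' := (LieSubmodule.mem_inf _ _ _).mpr ⟨hx, hx'⟩
  rwa [hd.eq_bot, LieSubmodule.mem_bot] at h

variable [FiniteDimensional F L]

theorem LieAlgebra.exists_disjoint_sup_eq_of_le_abelianSocle {J X : LieIdeal F L}
    (hJ : J ≤ abelianSocle F L) (hX : X ≤ J) : ∃ Y : LieIdeal F L, Disjoint X Y ∧ X ⊔ Y = J := by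
  obtain ⟨Y, ⟨hYA, hYX⟩, hmax⟩ := (inferInstance : WellFoundedGT (LieIdeal F L)).wf.has_min
    {Y | Y ≤ abelianSocle F L ∧ Disjoint X Y} ⟨⊥, bot_le, disjoint_bot_right⟩
  have hsup : abelianSocle F L ≤ X ⊔ Y := by
    refine sSup_le fun I hI => ?_
    by_contra hIXY
    have hd : Disjoint (X ⊔ Y) I := (hI.1.not_le_iff_disjoint.mp hIXY).symm
    refine hmax (Y ⊔ I) ⟨sup_le hYA (le_sSup hI),
      hYX.disjoint_sup_right_of_disjoint_sup_left hd⟩ (lt_of_le_of_ne le_sup_left fun h => ?_)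
    exact hIXY ((le_sup_right.trans h.ge).trans le_sup_right)
  refine ⟨Y ⊓ J, hYX.mono_right inf_le_left, ?_⟩
  rw [← sup_inf_assoc_of_le Y hX, inf_eq_right]
  exact hJ.trans hsup

/-- A supplement to a minimal ideal on which some radical element acts nontrivially. -/
theorem LieAlgebra.exists_supplements_of_lie_ne_zero
    (hJ : ∀ x ∈ ⁅(⊤ : LieIdeal F L), radical F L⁆, ∀ y ∈ ⁅(⊤ : LieIdeal F L), radical F L⁆,
      ⁅x, y⁆ = 0)
    (hI : IsAtom I) (hd : Disjoint I I') (hsup : I ⊔ I' = ⁅(⊤ : LieIdeal F L), radical F L⁆)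
    {r i : L} (hr : r ∈ radical F L) (hi : i ∈ I) (hri : ⁅r, i⁆ ≠ 0) :
    ∃ U : LieSubalgebra F L, U.Supplements I ∧ ∃ b ∈ I, b ∉ U := by
  have hIJ : I ≤ ⁅(⊤ : LieIdeal F L), radical F L⁆ := hsup ▸ le_sup_left
  let N : LieIdeal F L :=
    { carrier := {z | z ∈ I ∧ ⁅r, z⁆ = 0}
      add_mem' := fun hx hy => ⟨I.add_mem hx.1 hy.1, by rw [lie_add, hx.2, hy.2, add_zero]⟩
      zero_mem' := ⟨I.zero_mem, lie_zero r⟩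
      smul_mem' := fun c _ hx => ⟨I.smul_mem c hx.1, by rw [lie_smul, hx.2, smul_zero]⟩
      lie_mem := fun {y z} hz => ⟨I.lie_mem hz.1, by
        have hyr : ⁅r, y⁆ ∈ ⁅(⊤ : LieIdeal F L), radical F L⁆ := by
          rw [← lie_skew]
          exact neg_mem (LieSubmodule.lie_mem_lie (LieSubmodule.mem_top y) hr)
        rw [leibniz_lie, hz.2, lie_zero, add_zero]
        exact hJ _ hyr _ (hIJ hz.1)⟩ }
  have hN : N = ⊥ := (hI.le_iff.mp (fun z hz => hz.1 : N ≤ I)).resolve_right fun h => hri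
    (show i ∈ N from h ▸ hi).2
  have hinj : ∀ z ∈ I, ⁅r, z⁆ = 0 → z = 0 := fun z hz h => by
    have hz' : z ∈ N := ⟨hz, h⟩
    rwa [hN, LieSubmodule.mem_bot] at hz'
  have hsurj : ∀ y ∈ I, ∃ z ∈ I, ⁅r, z⁆ = y := by
    have : Function.Injective (toEnd F L I r) := by
      rw [injective_iff_map_eq_zero]
      exact fun z hz => Subtype.ext (hinj z z.2 (congrArg Subtype.val hz))
    intro y hy
    obtain ⟨z, hz⟩ := LinearMap.injective_iff_surjective.mp this ⟨y, hy⟩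
    exact ⟨z, z.2, congrArg Subtype.val hz⟩
  let U : LieSubalgebra F L :=
    { carrier := {x | ⁅r, x⁆ ∈ I'}
      add_mem' := fun {x y} hx hy => by
        change ⁅r, x + y⁆ ∈ I'
        rw [lie_add]
        exact add_mem hx hy
      zero_mem' := by simp
      smul_mem' := fun c x hx => by
        change ⁅r, c • x⁆ ∈ I'
        rw [lie_smul]
        exact I'.smul_mem c hx
      lie_mem' := fun {x y} hx hy => by
        change ⁅r, ⁅x, y⁆⁆ ∈ I'
        rw [leibniz_lie]
        exact add_mem (lie_mem_left F L I' _ _ hx) (lie_mem_right F L I' _ _ hy) }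
  refine ⟨U, fun x => ?_, i, hi, fun hiU => hri ?_⟩
  · have hx : ⁅x, r⁆ ∈ I ⊔ I' := hsup ▸ LieSubmodule.lie_mem_lie (LieSubmodule.mem_top x) hr
    obtain ⟨y, hy, y', hy', h⟩ := (LieSubmodule.mem_sup _ _ _).mp hx
    obtain ⟨z, hz, rfl⟩ := hsurj y hy
    refine ⟨x + z, ?_, by simpa using hz⟩
    change ⁅r, x + z⁆ ∈ I'
    have : ⁅r, x + z⁆ = -y' := by
      rw [lie_add, ← lie_skew, ← h]
      abel
    rw [this]
    exact neg_mem hy'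
  · exact LieIdeal.eq_zero_of_disjoint hd (I.lie_mem hi) hiU

/-- A supplement to a minimal ideal centralized by the radical. -/
theorem LieAlgebra.exists_supplements_of_lie_eq_zero [CharZero F]
    (hZ : ⁅(⊤ : LieIdeal F L), radical F L⁆ ⊓ center F L = ⊥)
    (hI : IsAtom I) (hd : Disjoint I I') (hsup : I ⊔ I' = ⁅(⊤ : LieIdeal F L), radical F L⁆)
    (hRI : ∀ r ∈ radical F L, ∀ i ∈ I, ⁅r, i⁆ = 0) :
    ∃ U : LieSubalgebra F L, U.Supplements I ∧ ∃ b ∈ I, b ∉ U := by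
  set J := ⁅(⊤ : LieIdeal F L), radical F L⁆
  have hIJ : I ≤ J := hsup ▸ le_sup_left
  have hIJ' : I' ≤ J := hsup ▸ le_sup_right
  have hJR : J ≤ radical F L := LieSubmodule.lie_le_right _ _
  have hlieJ : ∀ (y : L), ∀ r ∈ radical F L, ⁅y, r⁆ ∈ J := fun y r hr =>
    LieSubmodule.lie_mem_lie (LieSubmodule.mem_top y) hr
  have hdisj : ∀ x ∈ I, x ∈ I' → x = 0 :=
    fun _ => LieIdeal.eq_zero_of_disjoint hd
  have hcenter : ∀ z ∈ J, (∀ y : L, ⁅y, z⁆ = 0) → z = 0 := fun z hz h => by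
    have hz' : z ∈ J ⊓ center F L := (LieSubmodule.mem_inf _ _ _).mpr
      ⟨hz, (LieModule.mem_maxTrivSubmodule F L L z).mpr h⟩
    rwa [hZ, LieSubmodule.mem_bot] at hz'
  have hII' : ∀ i ∈ I, (∀ y : L, ⁅y, i⁆ ∈ I') → i = 0 := fun i hi h =>
    hcenter i (hIJ hi) fun y => hdisj _ (I.lie_mem hi) (h y)
  have hJr : ∀ j ∈ J, ∀ r ∈ radical F L, ⁅j, r⁆ ∈ I' := by
    intro j hj r hr
    obtain ⟨i, hi, i', hi', rfl⟩ := (LieSubmodule.mem_sup _ _ _).mp (hsup.symm ▸ hj)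
    rw [add_lie, ← lie_skew i, hRI r hr i hi, neg_zero, zero_add]
    exact lie_mem_left F L I' _ _ hi'
  have hRR : ∀ r ∈ radical F L, ∀ s ∈ radical F L, ⁅r, s⁆ ∈ I' := by
    intro r hr s hs
    obtain ⟨i, hi, i', hi', h⟩ := (LieSubmodule.mem_sup _ _ _).mp (hsup.symm ▸ hlieJ r s hs)
    have hi0 : i = 0 := hII' i hi fun y => by
      have h1 : ⁅y, ⁅r, s⁆⁆ ∈ I' := by
        rw [leibniz_lie, ← lie_skew r ⁅y, s⁆]
        exact add_mem (hJr _ (hlieJ y r hr) s hs) (neg_mem (hJr _ (hlieJ y s hs) r hr))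
      rw [← h, lie_add] at h1
      simpa using sub_mem h1 (I'.lie_mem (x := y) hi')
    rw [hi0, zero_add] at h
    exact h ▸ hi'
  let K : LieIdeal F L :=
    { carrier := {r | r ∈ radical F L ∧ ∀ y : L, ⁅y, r⁆ ∈ I'}
      add_mem' := fun hx hy => ⟨add_mem hx.1 hy.1, fun y => by
        rw [lie_add]
        exact add_mem (hx.2 y) (hy.2 y)⟩
      zero_mem' := ⟨zero_mem _, fun y => by simp⟩
      smul_mem' := fun c _ hx => ⟨SMulMemClass.smul_mem c hx.1, fun y => by
        rw [lie_smul]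
        exact I'.smul_mem c (hx.2 y)⟩
      lie_mem := fun {y r} hr => ⟨LieSubmodule.lie_mem _ hr.1, fun z => I'.lie_mem (hr.2 y)⟩ }
  have hRK : ∀ r ∈ radical F L, ∃ i ∈ I, r - i ∈ K := by
    intro r hr
    obtain ⟨w, hw, h⟩ := LieModule.exists_sub_lie_mem F (A := I') (W := J) (B := radical F L)
      hIJ' hJR hRR hlieJ hr
    obtain ⟨i, hi, i', hi', rfl⟩ := (LieSubmodule.mem_sup _ _ _).mp (hsup.symm ▸ hw)
    refine ⟨i, hi, sub_mem hr (hJR (hIJ hi)), fun y => ?_⟩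
    have := add_mem (h y) (I'.lie_mem (x := y) hi')
    rwa [← lie_add, ← sub_sub, sub_add_cancel] at this
  have hIK : Disjoint K.toSubmodule I.toSubmodule :=
    Submodule.disjoint_def.mpr fun x hxK hxI => hII' x hxI hxK.2
  obtain ⟨Q, hKQ, hQ⟩ := hIK.exists_isCompl
  let p : L →ₗ[F] L := I.toSubmodule.projection Q hQ.symm
  let W : LieSubmodule F L (L →ₗ[F] L) :=
    { carrier := {f | (∀ y, f y ∈ I) ∧ (∀ k ∈ K, f k = 0) ∧ ∀ i ∈ I, f i = 0}
      add_mem' := fun {f g} hf hg => ⟨fun y => add_mem (hf.1 y) (hg.1 y),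
        fun k hk => by simp [hf.2.1 k hk, hg.2.1 k hk],
        fun i hi => by simp [hf.2.2 i hi, hg.2.2 i hi]⟩
      zero_mem' := ⟨fun y => I.zero_mem, fun _ _ => rfl, fun _ _ => rfl⟩
      smul_mem' := fun c f hf => ⟨fun y => I.smul_mem c (hf.1 y),
        fun k hk => by simp [hf.2.1 k hk], fun i hi => by simp [hf.2.2 i hi]⟩
      lie_mem := fun {x f} hf => ⟨fun y => by
          rw [LieHom.lie_apply]
          exact sub_mem (I.lie_mem (hf.1 y)) (hf.1 _),
        fun k hk => by rw [LieHom.lie_apply, hf.2.1 k hk, hf.2.1 _ (K.lie_mem hk)]; simp,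
        fun i hi => by rw [LieHom.lie_apply, hf.2.2 i hi, hf.2.2 _ (I.lie_mem hi)]; simp⟩ }
  let B : LieSubmodule F L (L →ₗ[F] L) :=
    { carrier := {f | (∀ y, f y ∈ I) ∧ (∀ k ∈ K, f k = 0) ∧ ∃ c : F, ∀ i ∈ I, f i = c • i}
      add_mem' := by
        rintro f g ⟨hf, hf', c, hc⟩ ⟨hg, hg', d, hd⟩
        exact ⟨fun y => add_mem (hf y) (hg y), fun k hk => by simp [hf' k hk, hg' k hk],
          c + d, fun i hi => by simp [hc i hi, hd i hi, add_smul]⟩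
      zero_mem' := ⟨fun y => I.zero_mem, fun _ _ => rfl, 0, fun _ _ => by simp⟩
      smul_mem' := by
        rintro a f ⟨hf, hf', c, hc⟩
        exact ⟨fun y => I.smul_mem a (hf y), fun k hk => by simp [hf' k hk],
          a * c, fun i hi => by simp [hc i hi, mul_smul]⟩
      lie_mem := by
        rintro x f ⟨hf, hf', c, hc⟩
        exact ⟨fun y => by
          rw [LieHom.lie_apply]
          exact sub_mem (I.lie_mem (hf y)) (hf _),
          fun k hk => by rw [LieHom.lie_apply, hf' k hk, hf' _ (K.lie_mem hk)]; simp,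
          0, fun i hi => by rw [LieHom.lie_apply, hc i hi, hc _ (I.lie_mem hi)]; simp⟩ }
  let A : LieSubmodule F L (L →ₗ[F] L) :=
    { carrier := {f | ∃ a ∈ I, ∀ y, f y = ⁅a, y⁆}
      add_mem' := by
        rintro f g ⟨a, ha, hf⟩ ⟨b, hb, hg⟩
        exact ⟨a + b, add_mem ha hb, fun y => by simp [hf, hg]⟩
      zero_mem' := ⟨0, I.zero_mem, fun y => by simp⟩
      smul_mem' := by
        rintro c f ⟨a, ha, hf⟩
        exact ⟨c • a, I.smul_mem c ha, fun y => by simp [hf]⟩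
      lie_mem := by
        rintro x f ⟨a, ha, hf⟩
        exact ⟨⁅x, a⁆, I.lie_mem ha, fun y => by rw [LieHom.lie_apply, hf, hf, lie_lie]⟩ }
  have hIR : ∀ a ∈ I, ∀ r ∈ radical F L, ⁅a, r⁆ = 0 := fun a ha r hr => by
    rw [← lie_skew, hRI r hr a ha, neg_zero]
  obtain ⟨w, hw, h⟩ := LieModule.exists_sub_lie_mem F (A := A) (W := W) (B := B)
    (by
      rintro f ⟨a, ha, hf⟩
      exact ⟨fun y => hf y ▸ lie_mem_left F L I _ _ ha, fun k hk => by rw [hf, hIR a ha k hk.1],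
        fun i hi => by rw [hf, hIR a ha i (hJR (hIJ hi))]⟩)
    (fun f hf => ⟨hf.1, hf.2.1, 0, fun i hi => by rw [hf.2.2 i hi, zero_smul]⟩)
    (by
      rintro r hr f ⟨hf, hf', c, hc⟩
      obtain ⟨i, hi, hk⟩ := hRK r hr
      refine ⟨-(c • i), neg_mem (I.smul_mem c hi), fun y => ?_⟩
      have h1 : ⁅r, y⁆ = ⁅i, y⁆ + ⁅r - i, y⁆ := by simp
      rw [LieHom.lie_apply, hRI r hr _ (hf y), h1, map_add, hf' _ (lie_mem_left F L K _ _ hk),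
        hc _ (lie_mem_left F L I _ _ hi)]
      simp)
    (by
      rintro x f ⟨hf, hf', c, hc⟩
      exact ⟨fun y => by
        rw [LieHom.lie_apply]
        exact sub_mem (I.lie_mem (hf y)) (hf _),
        fun k hk => by rw [LieHom.lie_apply, hf' k hk, hf' _ (K.lie_mem hk)]; simp,
        fun i hi => by rw [LieHom.lie_apply, hc i hi, hc _ (I.lie_mem hi)]; simp⟩)
    (b := p) ⟨fun y => Submodule.projection_apply_mem _ _,
      fun k hk => Submodule.projection_apply_of_mem_right _ (hKQ hk),
      1, fun i hi => by rw [one_smul]; exact Submodule.projection_apply_of_mem_left _ hi⟩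
  set g := p - w
  have hgI : ∀ y, g y ∈ I := fun y => sub_mem (Submodule.projection_apply_mem _ _) (hw.1 y)
  have hg1 : ∀ i ∈ I, g i = i := fun i hi => by
    rw [LinearMap.sub_apply, hw.2.2 i hi, sub_zero]
    exact Submodule.projection_apply_of_mem_left _ hi
  have hag : ∀ a ∈ I, ∀ y, ⁅a, g⁆ y = -⁅a, y⁆ := fun a ha y => by
    rw [LieHom.lie_apply, hIR a ha _ (hJR (hIJ (hgI y))), hg1 _ (lie_mem_left F L I _ _ ha),
      zero_sub]
  let U : LieSubalgebra F L :=
    { carrier := {x | ⁅x, g⁆ = 0}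
      add_mem' := fun {x y} hx hy => by
        change ⁅x + y, g⁆ = 0
        rw [add_lie, hx, hy, add_zero]
      zero_mem' := zero_lie g
      smul_mem' := fun c x hx => by
        change ⁅c • x, g⁆ = 0
        rw [smul_lie, hx, smul_zero]
      lie_mem' := fun {x y} hx hy => by
        change ⁅⁅x, y⁆, g⁆ = 0
        rw [lie_lie, hx, hy, lie_zero, lie_zero, sub_zero] }
  obtain ⟨b, hb, hb0⟩ : ∃ b ∈ I, b ≠ 0 := by
    by_contra! h
    exact hI.1 ((LieSubmodule.eq_bot_iff I).mpr h)
  refine ⟨U, fun x => ?_, b, hb, fun hbU => hb0 (hcenter b (hIJ hb) fun y => ?_)⟩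
  · obtain ⟨a, ha, hxa⟩ := h x
    refine ⟨x + a, ?_, by simpa using ha⟩
    change ⁅x + a, g⁆ = 0
    ext y
    rw [add_lie, LinearMap.add_apply, hxa, hag a ha, LinearMap.zero_apply, add_neg_cancel]
  · have := hag b hb y
    rw [show ⁅b, g⁆ = 0 from hbU, LinearMap.zero_apply, lie_skew] at this
    exact this.symm

variable [CharZero F]

theorem LieAlgebra.exists_supplements_of_isAtom
    (hJ : ⁅(⊤ : LieIdeal F L), radical F L⁆ ≤ abelianSocle F L)
    (hZ : ⁅(⊤ : LieIdeal F L), radical F L⁆ ⊓ center F L = ⊥)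
    (hI : IsAtom I) (hIJ : I ≤ ⁅(⊤ : LieIdeal F L), radical F L⁆) :
    ∃ U : LieSubalgebra F L, U.Supplements I ∧ ∃ b ∈ I, b ∉ U := by
  obtain ⟨I', hd, hsup⟩ := exists_disjoint_sup_eq_of_le_abelianSocle hJ hIJ
  by_cases h : ∀ r ∈ radical F L, ∀ i ∈ I, ⁅r, i⁆ = 0
  · exact exists_supplements_of_lie_eq_zero hZ hI hd hsup h
  · push Not at h
    obtain ⟨r, hr, i, hi, hri⟩ := h
    exact exists_supplements_of_lie_ne_zero
      (fun x hx y hy => abelianSocle_lie_eq_zero x (hJ hx) y (hJ hy)) hI hd hsup hr hi hri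

theorem LieAlgebra.exists_isCoatom_notMem_of_mem_lie_radical
    (hJ : ⁅(⊤ : LieIdeal F L), radical F L⁆ ≤ abelianSocle F L)
    (hZ : ⁅(⊤ : LieIdeal F L), radical F L⁆ ⊓ center F L = ⊥)
    {x : L} (hxJ : x ∈ ⁅(⊤ : LieIdeal F L), radical F L⁆) (hx : x ≠ 0) :
    ∃ M : LieSubalgebra F L, IsCoatom M ∧ x ∉ M := by
  have hab := fun x hx y hy => abelianSocle_lie_eq_zero x (hJ hx) y (hJ hy)
  obtain ⟨U, hU, hdisj⟩ := LieSubalgebra.exists_supplements_disjoint hab fun B hBJ hB => by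
    obtain ⟨I, hIB, hI⟩ := LieIdeal.exists_isAtom_le hB
    obtain ⟨U, hU, b, hb, hbU⟩ := exists_supplements_of_isAtom hJ hZ hI (hIB.trans hBJ)
    refine ⟨U, fun y => ?_, b, hIB hb, hbU⟩
    obtain ⟨u, hu, hyu⟩ := hU y
    exact ⟨u, hu, hIB hyu⟩
  let X : LieIdeal F L := LieSubmodule.lieSpan F L {x}
  have hxX : x ∈ X := LieSubmodule.subset_lieSpan (Set.mem_singleton x)
  have hXle : ∀ N : LieIdeal F L, x ∈ N → X ≤ N := fun N hN =>
    LieSubmodule.lieSpan_le.mpr (Set.singleton_subset_iff.mpr hN)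
  obtain ⟨I, hIX, hI⟩ := LieIdeal.exists_isAtom_le (I := X) fun h => hx (by
    rwa [h, LieSubmodule.mem_bot] at hxX)
  obtain ⟨I', hd, hsup⟩ := exists_disjoint_sup_eq_of_le_abelianSocle hJ (hIX.trans (hXle _ hxJ))
  have hIJ' : I' ≤ ⁅(⊤ : LieIdeal F L), radical F L⁆ := hsup ▸ le_sup_right
  have hxM : x ∉ U.addIdeal I' := by
    rintro ⟨u, hu, hxu⟩
    have huJ := sub_mem hxJ (hIJ' hxu)
    rw [sub_sub_cancel] at huJ
    rw [hdisj u hu huJ, sub_zero] at hxu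
    exact hI.1 (disjoint_self.mp (hd.mono_right (hIX.trans (hXle I' hxu))))
  refine ⟨U.addIdeal I', ⟨fun h => hxM (h ▸ LieSubalgebra.mem_top x), fun K hK => ?_⟩, hxM⟩
  obtain ⟨hle, k, hk, hkM⟩ := SetLike.lt_iff_le_and_exists.mp hK
  have hUK : U ≤ K := (U.le_addIdeal I').trans hle
  have hKJ : K.Supplements ⁅(⊤ : LieIdeal F L), radical F L⁆ := fun y => by
    obtain ⟨u, hu, hyu⟩ := hU y
    exact ⟨u, hUK hu, hyu⟩
  obtain ⟨u, hu, hku⟩ := hU k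
  have hkuQ : k - u ∈ hKJ.idealInf hab := ⟨K.sub_mem hk (hUK hu), hku⟩
  have hI'Q : I' ≤ hKJ.idealInf hab := fun y hy => ⟨hle (U.mem_addIdeal_of_mem hy), hIJ' hy⟩
  have hIQ : I ≤ hKJ.idealInf hab := by
    refine inf_eq_left.mp ((hI.le_iff.mp inf_le_left).resolve_left fun h => hkM ?_)
    have hQ : hKJ.idealInf hab ≤ I' := by
      have h1 : hKJ.idealInf hab ≤ (I' ⊔ I) ⊓ hKJ.idealInf hab :=
        le_inf (by rw [sup_comm, hsup]; exact fun y hy => hy.2) le_rfl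
      rwa [sup_inf_assoc_of_le I hI'Q, h, sup_bot_eq] at h1
    exact ⟨u, hu, hQ hkuQ⟩
  rw [eq_top_iff]
  intro y _
  obtain ⟨v, hv, hyv⟩ := hU y
  have hyv' : y - v ∈ I ⊔ I' := hsup ▸ hyv
  have := K.add_mem (sup_le hIQ hI'Q hyv').1 (hUK hv)
  rwa [sub_add_cancel] at this

end Backward

/-- A nonzero finite-dimensional Lie algebra over a field of characteristic zero with
finitely many Lie ideals has trivial Frattini subalgebra (the intersection of all maximal
proper subalgebras) iff its Jacobson radical `⁅L, Rad L⁆` is contained in the abelian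
socle (the join of all minimal abelian ideals) and meets the centre trivially. -/
theorem frattini_eq_bot_iff
    (F : Type*) [Field F] [CharZero F]
    (L : Type*) [LieRing L] [LieAlgebra F L] [FiniteDimensional F L] [Nontrivial L]
    [Finite (LieIdeal F L)] :
    sInf {K : LieSubalgebra F L | IsCoatom K} = ⊥ ↔
      (⁅(⊤ : LieIdeal F L), LieAlgebra.radical F L⁆ ≤
          sSup {I : LieIdeal F L | IsAtom I ∧ IsLieAbelian I} ∧
        ⁅(⊤ : LieIdeal F L), LieAlgebra.radical F L⁆ ⊓ LieAlgebra.center F L = ⊥) := by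
  have hiff : sInf {K : LieSubalgebra F L | IsCoatom K} = ⊥ ↔
      ∀ x : L, x ≠ 0 → ∃ M : LieSubalgebra F L, IsCoatom M ∧ x ∉ M := by
    rw [LieSubalgebra.eq_bot_iff]
    refine forall_congr' fun x => ?_
    rw [← SetLike.mem_coe, LieSubalgebra.coe_sInf, not_imp_comm]
    simp
  rw [hiff]
  refine ⟨fun hφ => ⟨lie_radical_le_abelianSocle hφ, lie_radical_inf_center_eq_bot hφ⟩, ?_⟩
  rintro ⟨hJ, hZ⟩ x hx
  by_cases hxR : x ∈ radical F L
  · by_cases hxJ : x ∈ ⁅(⊤ : LieIdeal F L), radical F L⁆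
    · exact exists_isCoatom_notMem_of_mem_lie_radical hJ hZ hxJ hx
    · exact exists_isCoatom_notMem_of_notMem_lie_radical hxR hxJ
  · exact exists_isCoatom_notMem_of_notMem_radical hxR
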